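/- arXiv:1209.0177 — 11 statements merged into one kernel-verified Lean document; each statement's English description precedes it below -/
import Mathlib

section
/- Let 𝒜 be an infinite Boolean algebra with the weak subsequential separation property. Then 𝒜 contains an independent family of cardinality continuum, i.e. there exists an injective map x ↦ A_x from the Cantor set 2^ℕ into 𝒜 such that the family (A_x)_{x ∈ 2^ℕ} is independent. -/
/-- A Boolean algebra has the *weak subsequential separation property* if for every
injective sequence of pairwise disjoint nonzero elements `(Aₙ)` there is an `a` such that
both `{n | Aₙ ≤ a}` and `{n | Aₙ ⊓ a = ⊥}` are infinite. -/
def WeakSubseqSep (A : Type*) [BooleanAlgebra A] : Prop :=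
  ∀ f : ℕ → A, Function.Injective f → (∀ n, f n ≠ ⊥) →
    (∀ m n, m ≠ n → f m ⊓ f n = ⊥) →
    ∃ a : A, {n : ℕ | f n ≤ a}.Infinite ∧ {n : ℕ | f n ⊓ a = ⊥}.Infinite

/-- A family `(gᵢ)` in a Boolean algebra is *independent* if for all disjoint finite
`F, G ⊆ I` the element `⨅_{i ∈ F} gᵢ ⊓ ⨅_{i ∈ G} gᵢᶜ` is nonzero. -/
def IndepFamily {I A : Type*} [BooleanAlgebra A] (g : I → A) : Prop :=
  ∀ F G : Finset I, Disjoint F G →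
    (F.inf g ⊓ G.inf fun i => (g i)ᶜ) ≠ ⊥


/-- Every infinite Boolean algebra has an infinite sequence of disjoint nonzero elements. -/
theorem exists_disjoint_seq (A : Type*) [BooleanAlgebra A] [Infinite A] :
    ∃ f : ℕ → A, Function.Injective f ∧ (∀ n, f n ≠ ⊥) ∧
      (∀ m n, m ≠ n → f m ⊓ f n = ⊥) := by
  have step : ∀ a : {a : A // (Set.Iic a).Infinite}, ∃ b : {a : A // (Set.Iic a).Infinite},
      b.1 < a.1 := by
    classical
    rintro ⟨a, ha⟩
    obtain ⟨b, hb, hb'⟩ := ha.exists_notMem_finset {⊥, a}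
    simp only [Finset.mem_insert, Finset.mem_singleton, not_or] at hb'
    have hba : b ≤ a := hb
    by_cases h1 : (Set.Iic b).Infinite
    · exact ⟨⟨b, h1⟩, lt_of_le_of_ne hba hb'.2⟩
    · by_cases h2 : (Set.Iic (a \ b)).Infinite
      · refine ⟨⟨a \ b, h2⟩, lt_of_le_of_ne sdiff_le ?_⟩
        intro h
        change a \ b = a at h
        have hd : Disjoint a b := by
          have h3 : Disjoint (a \ b) b := disjoint_sdiff_self_left
          rwa [h] at h3
        exact hb'.1 (disjoint_self.1 (hd.mono_left hba))
      · exfalso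
        rw [Set.not_infinite] at h1 h2
        apply ha
        refine ((h1.prod h2).image (fun p : A × A => p.1 ⊔ p.2)).subset ?_
        intro x hx
        have hxa : x ≤ a := hx
        refine ⟨(x ⊓ b, x \ b), ⟨inf_le_right, sdiff_le_sdiff_right hxa⟩, ?_⟩
        exact sup_inf_sdiff x b
  choose nx hnx using step
  let a0 : {a : A // (Set.Iic a).Infinite} := ⟨⊤, by
    rw [Set.Iic_top]; exact Set.infinite_univ⟩
  let u : ℕ → {a : A // (Set.Iic a).Infinite} := fun n => nx^[n] a0
  have hu : ∀ n, (u (n+1)).1 < (u n).1 := by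
    intro n
    have : u (n+1) = nx (u n) := Function.iterate_succ_apply' nx n a0
    rw [this]; exact hnx _
  have hanti : Antitone (fun n => (u n).1) := antitone_nat_of_succ_le (fun n => (hu n).le)
  let f : ℕ → A := fun n => (u n).1 \ (u (n+1)).1
  have hne : ∀ n, f n ≠ ⊥ := by
    intro n h
    exact absurd (sdiff_eq_bot_iff.1 h) (not_le_of_gt (hu n))
  have hlt : ∀ m n, m < n → Disjoint (f m) (f n) := by
    intro m n hmn
    have h1 : f n ≤ (u (m+1)).1 := sdiff_le.trans (hanti hmn)
    exact disjoint_sdiff_self_left.mono_right h1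
  have hdis : ∀ m n, m ≠ n → f m ⊓ f n = ⊥ := by
    intro m n hmn
    rcases lt_or_gt_of_ne hmn with h | h
    · exact (hlt m n h).eq_bot
    · exact (hlt n m h).symm.eq_bot
  refine ⟨f, ?_, hne, hdis⟩
  intro m n h
  by_contra hmn
  have := hdis m n hmn
  rw [h, inf_idem] at this
  exact hne n this

/-- A countable independent sequence. -/
theorem exists_indep_seq (A : Type*) [BooleanAlgebra A] [Infinite A]
    (h : WeakSubseqSep A) :
    ∃ c : ℕ → A, ∀ (q : ℕ → Bool) (N : ℕ), ∃ e : A, e ≠ ⊥ ∧ ∀ n < N,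
      (q n = true → e ≤ c n) ∧ (q n = false → Disjoint e (c n)) := by
  obtain ⟨f, hinj, hne, hdis⟩ := exists_disjoint_seq A
  have split : ∀ M : {M : Set ℕ // M.Infinite}, ∃ a : A,
      (M.1 ∩ {n | f n ≤ a}).Infinite ∧ (M.1 ∩ {n | f n ≤ aᶜ}).Infinite := by
    rintro ⟨M, hM⟩
    obtain ⟨φ, hφ⟩ : ∃ φ : ℕ ↪ ℕ, ∀ n, φ n ∈ M :=
      ⟨(hM.natEmbedding).trans (Function.Embedding.subtype _), fun n => (Set.Infinite.natEmbedding M hM n).2⟩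
    obtain ⟨a, h1, h2⟩ := h (f ∘ φ) (hinj.comp φ.injective) (fun n => hne _)
      (fun m n hmn => hdis _ _ (fun h => hmn (φ.injective h)))
    refine ⟨a, (h1.image φ.injective.injOn).mono ?_, (h2.image φ.injective.injOn).mono ?_⟩
    · rintro _ ⟨n, hn, rfl⟩
      exact ⟨hφ n, hn⟩
    · rintro _ ⟨n, hn, rfl⟩
      exact ⟨hφ n, le_compl_iff_disjoint_right.2 (disjoint_iff.2 hn)⟩
  choose a ha1 ha2 using split
  let sg : A → Bool → A := fun x b => if b then x else xᶜ
  let M : List Bool → {M : Set ℕ // M.Infinite} := fun s => s.rec ⟨Set.univ, Set.infinite_univ⟩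
    (fun b _ m => ⟨m.1 ∩ {n | f n ≤ sg (a m) b}, by
      cases b
      · exact ha2 m
      · exact ha1 m⟩)
  let p : List Bool → A := fun s => s.rec ⊤ (fun b t r => r ⊓ sg (a (M t)) b)
  have hp : ∀ b s, p (b :: s) = p s ⊓ sg (a (M s)) b := fun b s => rfl
  have hMp : ∀ s, ∀ n ∈ (M s).1, f n ≤ p s := by
    intro s
    induction s with
    | nil => intro n _; exact le_top
    | cons b t ih =>
      intro n hn
      exact le_inf (ih n hn.1) hn.2
  have hpne : ∀ s, p s ≠ ⊥ := by
    intro s hs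
    obtain ⟨n, hn⟩ := (M s).2.nonempty
    exact hne n (le_bot_iff.1 (hs ▸ hMp s n hn))
  have hpd : ∀ s t : List Bool, s.length = t.length → s ≠ t → Disjoint (p s) (p t) := by
    intro s
    induction s with
    | nil =>
      intro t ht hst
      cases t with
      | nil => exact absurd rfl hst
      | cons => simp at ht
    | cons b s ih =>
      intro t ht hst
      cases t with
      | nil => simp at ht
      | cons b' t =>
        by_cases hs : s = t
        · subst hs
          have hb : b ≠ b' := fun h => hst (by rw [h])
          rw [hp, hp]
          refine Disjoint.mono inf_le_right inf_le_right ?_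
          cases b <;> cases b' <;> simp_all [sg, disjoint_compl_left, disjoint_compl_right]
        · rw [hp, hp]
          exact (ih t (by simpa using ht) hs).mono inf_le_left inf_le_left
  let c : ℕ → A := fun n =>
    (Finset.univ : Finset (List.Vector Bool n)).sup (fun v => p (true :: v.toList))
  have hc1 : ∀ s : List Bool, p (true :: s) ≤ c s.length := by
    intro s
    exact Finset.le_sup (f := fun v : List.Vector Bool s.length => p (true :: v.toList))
      (b := (⟨s, rfl⟩ : List.Vector Bool s.length)) (Finset.mem_univ _)
  have hc2 : ∀ s : List Bool, Disjoint (p (false :: s)) (c s.length) := by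
    intro s
    refine Finset.disjoint_sup_right.2 ?_
    intro v _
    refine hpd (false :: s) (true :: v.toList) ?_ ?_
    · simp
    · simp
  refine ⟨c, fun q N => ?_⟩
  let r : ℕ → List Bool := fun n => n.rec [] (fun k l => q k :: l)
  have hr : ∀ n, r (n+1) = q n :: r n := fun n => rfl
  have hrl : ∀ n, (r n).length = n := by
    intro n
    induction n with
    | zero => rfl
    | succ n ih => rw [hr, List.length_cons, ih]
  have hra : Antitone (fun n => p (r n)) := antitone_nat_of_succ_le (fun n => by
    show p (r (n+1)) ≤ p (r n)
    rw [hr, hp]; exact inf_le_left)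
  refine ⟨p (r N), hpne _, fun n hn => ?_⟩
  have hle : p (r N) ≤ p (q n :: r n) := hra (Nat.succ_le_of_lt hn)
  constructor
  · intro hq
    rw [hq] at hle
    have := hc1 (r n)
    rw [hrl] at this
    exact hle.trans this
  · intro hq
    rw [hq] at hle
    have := hc2 (r n)
    rw [hrl] at this
    exact this.mono_left hle

/-- Restriction of a point of the Cantor set to its first `n` coordinates. -/
def cantorRestr (x : ℕ → Bool) (n : ℕ) : List Bool := (List.range n).map x

theorem cantorRestr_eq {x y : ℕ → Bool} {m n : ℕ} (h : cantorRestr x m = cantorRestr y n) :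
    m = n ∧ ∀ j < m, x j = y j := by
  have hl : m = n := by simpa [cantorRestr] using congrArg List.length h
  subst hl
  refine ⟨rfl, fun j hj => ?_⟩
  exact List.map_inj_left.1 h j (List.mem_range.2 hj)

/-- Any infinite Boolean algebra with the weak subsequential separation property contains
an independent family of cardinality continuum, indexed injectively by the Cantor set `2^ℕ`. -/
theorem indep_family_continuum_of_weakSubseqSep (A : Type*) [BooleanAlgebra A] [Infinite A]
    (h : WeakSubseqSep A) :
    ∃ g : (ℕ → Bool) → A, Function.Injective g ∧ IndepFamily g := by
  classical
  obtain ⟨c0, hc0⟩ := exists_indep_seq A h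
  let c : List Bool → A := fun s => c0 (Encodable.encode s)
  have hc : ∀ (q : List Bool → Bool) (T : Finset (List Bool)), ∃ e : A, e ≠ ⊥ ∧ ∀ s ∈ T,
      (q s = true → e ≤ c s) ∧ (q s = false → Disjoint e (c s)) := by
    intro q T
    obtain ⟨e, he, H⟩ := hc0 (fun n => ((Encodable.decode n : Option (List Bool)).map q).getD true)
      (T.sup Encodable.encode + 1)
    refine ⟨e, he, fun s hs => ?_⟩
    have := H (Encodable.encode s) (Nat.lt_succ_of_le (Finset.le_sup hs))
    simpa using this
  let B : (ℕ → Bool) → ℕ → A := fun x n =>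
    c (cantorRestr x n) ⊓ (Finset.range n).inf (fun i => (c (cantorRestr x i))ᶜ)
  -- the key claim
  have key : ∀ S : Finset (ℕ → Bool), ∃ N : ℕ, ∀ k : (ℕ → Bool) → ℕ, (∀ x ∈ S, N ≤ k x) →
      ∃ e : A, e ≠ ⊥ ∧ ∀ x ∈ S, e ≤ B x (k x) := by
    intro S
    have hd : ∀ P : (ℕ → Bool) × (ℕ → Bool), ∃ N, P.1 ≠ P.2 → ∃ j < N, P.1 j ≠ P.2 j := by
      intro P
      by_cases hP : P.1 = P.2
      · exact ⟨0, fun h => absurd hP h⟩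
      · obtain ⟨j, hj⟩ := Function.ne_iff.1 hP
        exact ⟨j + 1, fun _ => ⟨j, Nat.lt_succ_self j, hj⟩⟩
    choose d hd using hd
    refine ⟨(S ×ˢ S).sup d, fun k hk => ?_⟩
    obtain ⟨e, he, H⟩ := hc (fun s => decide (∃ x ∈ S, s = cantorRestr x (k x)))
      (S.biUnion (fun x => (Finset.range (k x + 1)).image (cantorRestr x)))
    refine ⟨e, he, fun x hx => ?_⟩
    have H' : ∀ i ≤ k x, _ := fun i hi => H (cantorRestr x i)
      (Finset.mem_biUnion.2 ⟨x, hx, Finset.mem_image.2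
        ⟨i, Finset.mem_range.2 (Nat.lt_succ_of_le hi), rfl⟩⟩)
    refine le_inf ((H' (k x) le_rfl).1 (decide_eq_true ⟨x, hx, rfl⟩)) (Finset.le_inf ?_)
    intro i hi
    have hi' := Finset.mem_range.1 hi
    refine le_compl_iff_disjoint_right.2 ((H' i hi'.le).2 (decide_eq_false ?_))
    rintro ⟨y, hy, hxy⟩
    obtain ⟨h1, h2⟩ := cantorRestr_eq hxy
    by_cases hne : x = y
    · subst hne; omega
    · obtain ⟨j, hj, hj'⟩ := hd (x, y) hne
      have h3 : d (x, y) ≤ (S ×ˢ S).sup d := Finset.le_sup (Finset.mk_mem_product hx hy)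
      have h4 := hk y hy
      exact hj' (h2 j (by omega))
  have hBne : ∀ x n, B x n ≠ ⊥ := by
    intro x n hB
    obtain ⟨e, he, H⟩ := hc (fun s => decide (s = cantorRestr x n))
      ((Finset.range (n + 1)).image (cantorRestr x))
    have H' : ∀ i ≤ n, _ := fun i hi => H (cantorRestr x i)
      (Finset.mem_image.2 ⟨i, Finset.mem_range.2 (Nat.lt_succ_of_le hi), rfl⟩)
    have : e ≤ B x n := by
      refine le_inf ((H' n le_rfl).1 (decide_eq_true rfl)) (Finset.le_inf ?_)
      intro i hi
      have hi' := Finset.mem_range.1 hi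
      refine le_compl_iff_disjoint_right.2 ((H' i hi'.le).2 (decide_eq_false ?_))
      intro hxy
      have := (cantorRestr_eq hxy).1
      omega
    exact he (le_bot_iff.1 (hB ▸ this))
  have hBlt : ∀ x m n, m < n → Disjoint (B x m) (B x n) := by
    intro x m n hmn
    have h1 : B x n ≤ (c (cantorRestr x m))ᶜ :=
      inf_le_right.trans (Finset.inf_le (Finset.mem_range.2 hmn))
    exact disjoint_compl_right.mono inf_le_left h1
  have hBd : ∀ x m n, m ≠ n → B x m ⊓ B x n = ⊥ := by
    intro x m n hmn
    rcases lt_or_gt_of_ne hmn with h | h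
    · exact (hBlt x m n h).eq_bot
    · exact (hBlt x n m h).symm.eq_bot
  have hBi : ∀ x, Function.Injective (B x) := by
    intro x m n h
    by_contra hmn
    have := hBd x m n hmn
    rw [h, inf_idem] at this
    exact hBne x n this
  choose g hg1 hg2 using fun x => h (B x) (hBi x) (hBne x) (hBd x)
  have hind : IndepFamily g := by
    intro F G hFG hbot
    obtain ⟨N, hN⟩ := key (F ∪ G)
    choose k1 hk1 hk1' using fun x => (hg1 x).exists_gt N
    choose k2 hk2 hk2' using fun x => (hg2 x).exists_gt N
    obtain ⟨e, he, H⟩ := hN (fun x => if x ∈ F then k1 x else k2 x) (by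
      intro x _
      split_ifs
      · exact (hk1' x).le
      · exact (hk2' x).le)
    apply he
    rw [← le_bot_iff, ← hbot]
    refine le_inf (Finset.le_inf fun x hx => ?_) (Finset.le_inf fun x hx => ?_)
    · have := H x (Finset.mem_union_left _ hx)
      rw [if_pos hx] at this
      exact this.trans (hk1 x)
    · have := H x (Finset.mem_union_right _ hx)
      rw [if_neg (fun h => Finset.disjoint_left.1 hFG h hx)] at this
      exact this.trans (le_compl_iff_disjoint_right.2 (disjoint_iff.2 (hk2 x)))
  refine ⟨g, ?_, hind⟩
  intro x y hxy
  by_contra hne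
  apply hind {x} {y} (Finset.disjoint_singleton.2 hne)
  simp [hxy]
end

section
/- Let 𝒜 be an infinite Boolean algebra with the subsequential completeness property. Then 𝒜 contains an independent family of cardinality continuum, i.e. there exists an injective map x ↦ A_x from 2^ℕ into 𝒜 such that (A_x)_{x ∈ 2^ℕ} is independent. -/
/-- A Boolean algebra has the *subsequential completeness property* if every injective
sequence of pairwise disjoint nonzero elements has an infinite subfamily possessing a
supremum in the algebra. -/
def SubseqComplete (A : Type*) [BooleanAlgebra A] : Prop :=
  ∀ f : ℕ → A, Function.Injective f → (∀ n, f n ≠ ⊥) →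
    (∀ m n, m ≠ n → f m ⊓ f n = ⊥) →
    ∃ M : Set ℕ, M.Infinite ∧ ∃ s : A, IsLUB (f '' M) s

/-- There is an infinite disjoint sequence of nonzero elements below `a`. -/
def BigElt {A : Type*} [BooleanAlgebra A] (a : A) : Prop :=
  ∃ f : ℕ → A, (∀ n, f n ≤ a) ∧ (∀ n, f n ≠ ⊥) ∧ ∀ m n, m ≠ n → f m ⊓ f n = ⊥

theorem disj_injective {A : Type*} [BooleanAlgebra A] {f : ℕ → A} (h0 : ∀ n, f n ≠ ⊥)
    (hd : ∀ m n, m ≠ n → f m ⊓ f n = ⊥) : Function.Injective f := by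
  intro m n hmn
  by_contra hne
  have := hd m n hne
  rw [hmn, inf_idem] at this
  exact h0 n this

theorem BigElt.ne_bot {A : Type*} [BooleanAlgebra A] {a : A} (h : BigElt a) : a ≠ ⊥ := by
  obtain ⟨f, hf, h0, -⟩ := h
  rintro rfl
  exact h0 0 (le_bot_iff.1 (hf 0))

theorem exists_smaller {A : Type*} [BooleanAlgebra A] (a : A) (ha : (Set.Iic a).Infinite) :
    ∃ b, (Set.Iic b).Infinite ∧ b ≤ a ∧ a \ b ≠ ⊥ := by
  have key : ∀ b, b ≤ a → (Set.Iic b).Infinite ∨ (Set.Iic (a \ b)).Infinite := by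
    intro b hb
    by_contra hcon
    rw [not_or, Set.not_infinite, Set.not_infinite] at hcon
    apply ha
    refine (Set.Finite.image2 (fun x y => x ⊔ y) hcon.1 hcon.2).subset ?_
    intro c hc
    refine ⟨c ⊓ b, inf_le_right, c \ b, sdiff_le_sdiff_right hc, ?_⟩
    exact sup_inf_sdiff c b
  obtain ⟨b, hb, hb'⟩ := ha.exists_notMem_finite (Set.toFinite {⊥, a})
  simp only [Set.mem_insert_iff, Set.mem_singleton_iff, not_or] at hb'
  have hba : b ≤ a := hb
  rcases key b hba with h1 | h1
  · refine ⟨b, h1, hba, ?_⟩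
    intro h2
    exact hb'.2 (le_antisymm hba (sdiff_eq_bot_iff.1 h2))
  · refine ⟨a \ b, h1, sdiff_le, ?_⟩
    rw [sdiff_sdiff_right_self, inf_eq_right.2 hba]
    exact hb'.1

theorem bigElt_top {A : Type*} [BooleanAlgebra A] [Infinite A] : BigElt (⊤ : A) := by
  choose! s hs using (exists_smaller (A := A))
  have h0 : ∀ n, (Set.Iic (s^[n] ⊤)).Infinite := by
    intro n
    induction n with
    | zero => simpa using Set.infinite_univ
    | succ n ih =>
      rw [Function.iterate_succ_apply']
      exact (hs _ ih).1
  have hanti : Antitone fun n => s^[n] ⊤ := by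
    apply antitone_nat_of_succ_le
    intro n
    rw [Function.iterate_succ_apply']
    exact (hs _ (h0 n)).2.1
  have hlt : ∀ m n, m < n →
      (s^[m] ⊤ \ s^[m+1] ⊤) ⊓ (s^[n] ⊤ \ s^[n+1] ⊤) = ⊥ := by
    intro m n hmn
    have h1 : s^[n] ⊤ ≤ s^[m+1] ⊤ := hanti hmn
    exact (disjoint_sdiff_self_left.mono_right (sdiff_le.trans h1)).eq_bot
  refine ⟨fun n => s^[n] ⊤ \ s^[n+1] ⊤, fun n => le_top, ?_, ?_⟩
  · intro n
    dsimp only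
    rw [Function.iterate_succ_apply']
    exact (hs _ (h0 n)).2.2
  · intro m n hmn
    rcases lt_or_gt_of_ne hmn with h1 | h1
    · exact hlt m n h1
    · rw [inf_comm]; exact hlt n m h1

theorem BigElt.split {A : Type*} [BooleanAlgebra A] (h : SubseqComplete A) (a : A)
    (ha : BigElt a) : ∃ b, b ≤ a ∧ BigElt b ∧ BigElt (a \ b) := by
  obtain ⟨f, hfa, h0, hd⟩ := ha
  have hd2 : ∀ m n, m ≠ n → f (2 * m) ⊓ f (2 * n) = ⊥ := fun m n hmn => hd _ _ (by omega)
  obtain ⟨M, hM, s, hs⟩ := h (fun n => f (2 * n)) (disj_injective (fun n => h0 _) hd2)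
    (fun n => h0 _) hd2
  refine ⟨s, ?_, ?_, ?_⟩
  · apply hs.2
    rintro _ ⟨n, -, rfl⟩
    exact hfa _
  · refine ⟨fun n => f (2 * Nat.nth (· ∈ M) n), ?_, fun n => h0 _, ?_⟩
    · intro n
      exact hs.1 ⟨_, Nat.nth_mem_of_infinite hM n, rfl⟩
    · intro m n hmn
      apply hd2
      intro he
      exact hmn (Nat.nth_injective hM he)
  · refine ⟨fun n => f (2 * n + 1), ?_, fun n => h0 _, fun m n hmn => hd _ _ (by omega)⟩
    intro n
    rw [le_sdiff]
    refine ⟨hfa _, ?_⟩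
    rw [← le_compl_iff_disjoint_left]
    apply hs.2
    rintro _ ⟨m, -, rfl⟩
    exact (disjoint_iff.2 (hd _ _ (by omega))).le_compl_right

/-- The recursively built independent sequence. -/
def seqE {A : Type*} [BooleanAlgebra A] (L : A → A) : ℕ → A → A
  | 0, a => L a
  | n + 1, a => seqE L n (L a) ⊔ seqE L n (a \ L a)

theorem seqE_le {A : Type*} [BooleanAlgebra A] (L : A → A)
    (hL : ∀ a, BigElt a → L a ≤ a ∧ BigElt (L a) ∧ BigElt (a \ L a)) (n : ℕ) :
    ∀ a, BigElt a → seqE L n a ≤ a := by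
  induction n with
  | zero => intro a ha; exact (hL a ha).1
  | succ n ih =>
    intro a ha
    obtain ⟨h1, h2, h3⟩ := hL a ha
    exact sup_le ((ih _ h2).trans h1) ((ih _ h3).trans sdiff_le)

theorem seqE_indep {A : Type*} [BooleanAlgebra A] (L : A → A)
    (hL : ∀ a, BigElt a → L a ≤ a ∧ BigElt (L a) ∧ BigElt (a \ L a)) (N : ℕ) :
    ∀ (ε : ℕ → Prop) (a : A), BigElt a → ∃ c, BigElt c ∧ c ≤ a ∧
      ∀ n < N, (ε n → c ≤ seqE L n a) ∧ (¬ ε n → Disjoint c (seqE L n a)) := by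
  induction N with
  | zero => intro ε a ha; exact ⟨a, ha, le_rfl, by simp⟩
  | succ N ih =>
    intro ε a ha
    obtain ⟨h1, h2, h3⟩ := hL a ha
    by_cases h0 : ε 0
    · obtain ⟨c, hc, hca, H⟩ := ih (fun n => ε (n + 1)) _ h2
      refine ⟨c, hc, hca.trans h1, ?_⟩
      rintro (_ | n) hn
      · exact ⟨fun _ => hca, fun h => absurd h0 h⟩
      · obtain ⟨H1, H2⟩ := H n (by omega)
        refine ⟨fun h => (H1 h).trans le_sup_left, fun h => ?_⟩
        refine Disjoint.sup_right (H2 h) ?_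
        exact disjoint_sdiff_self_right.mono hca (seqE_le L hL n _ h3)
    · obtain ⟨c, hc, hca, H⟩ := ih (fun n => ε (n + 1)) _ h3
      refine ⟨c, hc, hca.trans sdiff_le, ?_⟩
      rintro (_ | n) hn
      · exact ⟨fun h => absurd h h0, fun _ => disjoint_sdiff_self_left.mono_left hca⟩
      · obtain ⟨H1, H2⟩ := H n (by omega)
        refine ⟨fun h => (H1 h).trans le_sup_right, fun h => ?_⟩
        refine Disjoint.sup_right ?_ (H2 h)
        exact disjoint_sdiff_self_left.mono hca (seqE_le L hL n _ h2)

theorem exists_indep_list {A : Type*} [BooleanAlgebra A] [Infinite A] (h : SubseqComplete A) :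
    ∃ e : List Bool → A, ∀ (ε : List Bool → Prop) (S : Finset (List Bool)),
      ∃ c : A, c ≠ ⊥ ∧ ∀ l ∈ S, (ε l → c ≤ e l) ∧ (¬ ε l → Disjoint c (e l)) := by
  choose! L hL using (BigElt.split h)
  refine ⟨fun l => seqE L (Encodable.encode l) ⊤, fun ε S => ?_⟩
  obtain ⟨c, hc, -, H⟩ := seqE_indep L hL (S.sup Encodable.encode + 1)
    (fun n => ∃ l, Encodable.encode l = n ∧ ε l) ⊤ bigElt_top
  refine ⟨c, hc.ne_bot, fun l hl => ?_⟩
  obtain ⟨H1, H2⟩ := H (Encodable.encode l)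
    (Nat.lt_succ_of_le (Finset.le_sup (f := Encodable.encode) hl))
  refine ⟨fun hε => H1 ⟨l, rfl, hε⟩, fun hε => H2 ?_⟩
  rintro ⟨l', hl', hε'⟩
  rw [Encodable.encode_injective hl'] at hε'
  exact hε hε'

/-- Initial segment of `x` of length `n`. -/
def initSeg (x : ℕ → Bool) (n : ℕ) : List Bool := (List.range n).map x

theorem initSeg_eq {x y : ℕ → Bool} {m n : ℕ} (h : initSeg x m = initSeg y n) :
    m = n ∧ ∀ i < m, x i = y i := by
  have h1 : m = n := by simpa [initSeg] using congrArg List.length h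
  subst h1
  refine ⟨rfl, fun i hi => ?_⟩
  have := List.map_inj_left.1 h
  exact this i (List.mem_range.2 hi)

/-- The pieces. -/
def pieceP {A : Type*} [BooleanAlgebra A] (e : List Bool → A) (x : ℕ → Bool) (n : ℕ) : A :=
  e (initSeg x n) \ (Finset.range n).sup fun k => e (initSeg x k)

theorem pieceP_disj {A : Type*} [BooleanAlgebra A] (e : List Bool → A) (x : ℕ → Bool)
    (m n : ℕ) (hmn : m ≠ n) : pieceP e x m ⊓ pieceP e x n = ⊥ := by
  have hlt : ∀ m n, m < n → pieceP e x m ⊓ pieceP e x n = ⊥ := by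
    intro m n hmn
    have h1 : pieceP e x m ≤ (Finset.range n).sup fun k => e (initSeg x k) :=
      sdiff_le.trans (Finset.le_sup (f := fun k => e (initSeg x k)) (Finset.mem_range.2 hmn))
    exact (disjoint_sdiff_self_right.mono_left h1).eq_bot
  rcases lt_or_gt_of_ne hmn with h1 | h1
  · exact hlt m n h1
  · rw [inf_comm]; exact hlt n m h1

theorem exists_sep (H : Finset (ℕ → Bool)) :
    ∃ K, ∀ x ∈ H, ∀ y ∈ H, (∀ i < K, x i = y i) → x = y := by
  have : ∀ x y : ℕ → Bool, ∃ d, x ≠ y → x d ≠ y d := by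
    intro x y
    by_cases hxy : x = y
    · exact ⟨0, fun h => absurd hxy h⟩
    · obtain ⟨d, hd⟩ := Function.ne_iff.1 hxy
      exact ⟨d, fun _ => hd⟩
  choose d hd using this
  refine ⟨(H ×ˢ H).sup (fun p => d p.1 p.2) + 1, fun x hx y hy hxy => ?_⟩
  by_contra hne
  refine hd x y hne (hxy _ (Nat.lt_succ_of_le ?_))
  exact Finset.le_sup (f := fun p : (ℕ → Bool) × (ℕ → Bool) => d p.1 p.2)
    (Finset.mk_mem_product hx hy)

theorem pieceP_indep {A : Type*} [BooleanAlgebra A] (e : List Bool → A)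
    (he : ∀ (ε : List Bool → Prop) (S : Finset (List Bool)),
      ∃ c : A, c ≠ ⊥ ∧ ∀ l ∈ S, (ε l → c ≤ e l) ∧ (¬ ε l → Disjoint c (e l)))
    (H : Finset (ℕ → Bool)) (K : ℕ)
    (hK : ∀ x ∈ H, ∀ y ∈ H, (∀ i < K, x i = y i) → x = y)
    (N : (ℕ → Bool) → ℕ) (hN : ∀ x, K ≤ N x) :
    ∃ c : A, c ≠ ⊥ ∧ ∀ x ∈ H, c ≤ pieceP e x (N x) := by
  classical
  obtain ⟨c, hc, hcS⟩ := he (fun l => ∃ y ∈ H, initSeg y (N y) = l)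
    (H.biUnion fun x => (Finset.range (N x + 1)).image (initSeg x))
  refine ⟨c, hc, fun x hx => ?_⟩
  have hmem : ∀ k ≤ N x, initSeg x k ∈
      (H.biUnion fun x => (Finset.range (N x + 1)).image (initSeg x)) := by
    intro k hk
    exact Finset.mem_biUnion.2 ⟨x, hx, Finset.mem_image_of_mem _
      (Finset.mem_range.2 (Nat.lt_succ_of_le hk))⟩
  rw [pieceP, le_sdiff]
  refine ⟨(hcS _ (hmem _ le_rfl)).1 ⟨x, hx, rfl⟩, ?_⟩
  rw [Finset.disjoint_sup_right]
  intro k hk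
  have hk' := Finset.mem_range.1 hk
  apply (hcS _ (hmem k hk'.le)).2
  rintro ⟨y, hy, hyk⟩
  obtain ⟨h1, h2⟩ := initSeg_eq hyk
  have hxy : y = x := hK y hy x hx fun i hi => h2 i (hi.trans_le (hN y))
  subst hxy
  omega

/-- Any infinite Boolean algebra with the subsequential completeness property contains
an independent family of cardinality continuum, indexed injectively by `2^ℕ`. -/
theorem indep_family_continuum_of_subseqComplete (A : Type*) [BooleanAlgebra A] [Infinite A]
    (h : SubseqComplete A) :
    ∃ g : (ℕ → Bool) → A, Function.Injective g ∧ IndepFamily g := by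
  classical
  obtain ⟨e, he⟩ := exists_indep_list h
  have hP0 : ∀ x n, pieceP e x n ≠ ⊥ := by
    intro x n
    obtain ⟨c, hc, hcx⟩ := pieceP_indep e he {x} 0 (by simp) (fun _ => n) (by simp)
    exact ne_bot_of_le_ne_bot hc (hcx x (by simp))
  have hsup : ∀ x, ∃ M : Set ℕ, M.Infinite ∧ ∃ s : A,
      IsLUB ((fun n => pieceP e x (2 * n)) '' M) s := by
    intro x
    have hd : ∀ m n, m ≠ n → pieceP e x (2 * m) ⊓ pieceP e x (2 * n) = ⊥ :=
      fun m n hmn => pieceP_disj e x _ _ (by omega)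
    exact h _ (disj_injective (fun n => hP0 x _) hd) (fun n => hP0 x _) hd
  choose M hM g hg using hsup
  have hind : IndepFamily g := by
    intro F G hFG
    obtain ⟨K, hK⟩ := exists_sep (F ∪ G)
    have hex : ∀ x, ∃ n ∈ M x, K < n := fun x => (hM x).exists_gt K
    choose r hrM hrK using hex
    obtain ⟨c, hc, hcx⟩ := pieceP_indep e he (F ∪ G) K hK
      (fun x => if x ∈ F then 2 * r x else 2 * K + 1) (by
        intro x
        have := hrK x
        split_ifs <;> omega)
    refine ne_bot_of_le_ne_bot hc (le_inf (Finset.le_inf ?_) (Finset.le_inf ?_))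
    · intro x hx
      have h1 := hcx x (Finset.mem_union_left _ hx)
      rw [if_pos hx] at h1
      exact h1.trans ((hg x).1 ⟨r x, hrM x, rfl⟩)
    · intro x hx
      have h1 := hcx x (Finset.mem_union_right _ hx)
      rw [if_neg (Finset.disjoint_right.1 hFG hx)] at h1
      refine h1.trans ?_
      rw [le_compl_comm]
      apply (hg x).2
      rintro _ ⟨m, -, rfl⟩
      exact (disjoint_iff.2 (pieceP_disj e x _ _ (by omega))).le_compl_right
  refine ⟨g, ?_, hind⟩
  intro x y hxy
  by_contra hne
  apply hind {x} {y} (by simpa using hne)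
  simp [hxy]
end

section
/- Every Boolean algebra with the subsequential completeness property has the weak subsequential separation property. -/
/-- Every Boolean algebra with the subsequential completeness property has the weak
subsequential separation property. -/
theorem weakSubseqSep_of_subseqComplete (A : Type*) [BooleanAlgebra A]
    (h : SubseqComplete A) : WeakSubseqSep A := by
  intro f hinj hne hdisj
  obtain ⟨M, hM, s, hs⟩ := h (fun n => f (2 * n))
    (fun a b hab => by have := hinj hab; omega) (fun n => hne _)
    (fun m n hmn => hdisj _ _ (by omega))
  refine ⟨s, ?_, ?_⟩
  · have h1 : ((fun n : ℕ => 2 * n) '' M).Infinite :=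
      hM.image (fun a _ b _ hab => by omega)
    refine h1.mono ?_
    rintro _ ⟨n, hn, rfl⟩
    exact hs.1 ⟨n, hn, rfl⟩
  · have h1 : (Set.range (fun n : ℕ => 2 * n + 1)).Infinite :=
      Set.infinite_range_of_injective (fun a b hab => by omega)
    refine h1.mono ?_
    rintro _ ⟨n, rfl⟩
    have h2 : s ≤ (f (2 * n + 1))ᶜ := by
      apply hs.2
      rintro _ ⟨m, _, rfl⟩
      exact le_compl_iff_disjoint_right.2 (disjoint_iff.2 (hdisj _ _ (by omega)))
    exact disjoint_iff.1 (le_compl_iff_disjoint_right.1 h2).symm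
end

section
/- Let 𝒜 be an infinite Boolean algebra with the weak subsequential separation property and let K_𝒜 be its Stone space. Then K_𝒜 contains no nontrivial convergent sequence: every sequence of points of K_𝒜 that converges in K_𝒜 is eventually constant. -/
/-- A map `A → Bool` that is a Boolean homomorphism (an "ultrafilter" on `A`). -/
def IsBoolHom {A : Type*} [BooleanAlgebra A] (x : A → Bool) : Prop :=
  x ⊤ = true ∧ x ⊥ = false ∧ (∀ a b, x (a ⊓ b) = (x a && x b)) ∧
    (∀ a b, x (a ⊔ b) = (x a || x b))

/-- The Stone space of a Boolean algebra: the space of Boolean homomorphisms `A → Bool`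
(equivalently, ultrafilters on `A`), with the topology induced from the product topology
on `A → Bool` (`Bool` discrete); this is the topology generated by the sets
`[a] = {x | x a = true}` for `a : A`. -/
def StoneSpace (A : Type*) [BooleanAlgebra A] : Type _ :=
  {x : A → Bool // IsBoolHom x}

instance (A : Type*) [BooleanAlgebra A] : TopologicalSpace (StoneSpace A) :=
  inferInstanceAs (TopologicalSpace {x : A → Bool // IsBoolHom x})

/-- The Stone space of an infinite Boolean algebra with the weak subsequential separation
property has no nontrivial convergent sequences: every convergent sequence is eventually
constant. -/
theorem eventually_const_of_converges_of_weakSubseqSep (A : Type*) [BooleanAlgebra A]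
    [Infinite A] (h : WeakSubseqSep A)
    (x : ℕ → StoneSpace A) (p : StoneSpace A)
    (hx : Filter.Tendsto x Filter.atTop (nhds p)) :
    ∃ N : ℕ, ∀ n : ℕ, N ≤ n → x n = x N := by
  classical
  have hev : ∀ a : A, ∀ᶠ n in Filter.atTop, (x n).1 a = p.1 a := by
    intro a
    have hc : Continuous (fun y : StoneSpace A => y.1 a) :=
      (continuous_apply a).comp continuous_subtype_val
    have := (hc.tendsto p).comp hx
    rw [nhds_discrete, Filter.tendsto_pure] at this
    exact this
  have hcompl : ∀ (y : StoneSpace A) (a : A), y.1 aᶜ = !(y.1 a) := by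
    intro y a
    obtain ⟨h1, h2, h3, h4⟩ := y.2
    have e1 := h3 a aᶜ
    have e2 := h4 a aᶜ
    rw [inf_compl_eq_bot, h2] at e1
    rw [sup_compl_eq_top, h1] at e2
    revert e1 e2
    cases y.1 a <;> cases y.1 aᶜ <;> simp
  by_contra hcon
  have hfreq : ∀ N : ℕ, ∃ n, N ≤ n ∧ x n ≠ p := by
    intro N
    by_contra hN
    push Not at hN
    exact hcon ⟨N, fun n hn => (hN n hn).trans (hN N le_rfl).symm⟩
  have step : ∀ s : {b : A // p.1 b = true} × ℕ, ∃ t : A × ℕ,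
      t.1 ≤ s.1.1 ∧ p.1 t.1 = false ∧ s.2 < t.2 ∧ (x t.2).1 t.1 = true := by
    rintro ⟨⟨b, hb⟩, N⟩
    obtain ⟨M, hM⟩ := Filter.eventually_atTop.1 (hev b)
    obtain ⟨n, hn, hne⟩ := hfreq (max M (N + 1))
    have hxb : (x n).1 b = true := (hM n (le_trans (le_max_left _ _) hn)).trans hb
    have hnN : N < n := lt_of_lt_of_le (Nat.lt_succ_self N) (le_trans (le_max_right _ _) hn)
    have : ∃ a, (x n).1 a = true ∧ p.1 a = false := by
      by_contra hno
      push Not at hno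
      apply hne
      apply Subtype.ext
      funext a
      have h1 := hno a
      have h2 := hno aᶜ
      rw [hcompl, hcompl] at h2
      revert h1 h2
      cases (x n).1 a <;> cases p.1 a <;> simp
    obtain ⟨a, ha, hpa⟩ := this
    refine ⟨(b ⊓ a, n), inf_le_left, ?_, hnN, ?_⟩
    · simp [p.2.2.2.1, hpa]
    · simp [(x n).2.2.2.1, hxb, ha]
  choose F hF1 hF2 hF3 hF4 using step
  let g : {b : A // p.1 b = true} × ℕ → {b : A // p.1 b = true} × ℕ := fun s =>
    (⟨s.1.1 ⊓ (F s).1ᶜ, by rw [p.2.2.2.1, hcompl, s.1.2, hF2]; rfl⟩, (F s).2)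
  let s : ℕ → {b : A // p.1 b = true} × ℕ := fun k =>
    Nat.rec (⟨⊤, p.2.1⟩, 0) (fun _ r => g r) k
  have hs : ∀ k, s (k + 1) = g (s k) := fun k => rfl
  have hanti : Antitone (fun k => (s k).1.1) :=
    antitone_nat_of_succ_le fun k => by rw [hs]; exact inf_le_left
  have hdisj' : ∀ m n, m < n → (F (s m)).1 ⊓ (F (s n)).1 = ⊥ := by
    intro m n hmn
    have h1 : (F (s n)).1 ≤ (F (s m)).1ᶜ :=
      (hF1 (s n)).trans ((hanti (Nat.succ_le_of_lt hmn)).trans (by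
        show (s (m + 1)).1.1 ≤ _
        rw [hs]; exact inf_le_right))
    exact (disjoint_compl_right.mono_right h1).eq_bot
  have hdisj : ∀ m n, m ≠ n → (F (s m)).1 ⊓ (F (s n)).1 = ⊥ := by
    intro m n hmn
    rcases lt_or_gt_of_ne hmn with h1 | h1
    · exact hdisj' m n h1
    · rw [inf_comm]; exact hdisj' n m h1
  have hne : ∀ n, (F (s n)).1 ≠ ⊥ := by
    intro n hn
    have := hF4 (s n)
    rw [hn, (x _).2.2.1] at this
    exact Bool.noConfusion this
  have hinj : Function.Injective (fun n => (F (s n)).1) := by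
    intro m n hmn
    by_contra hmn'
    have h1 := hdisj m n hmn'
    simp only at hmn
    rw [hmn, inf_idem] at h1
    exact hne n h1
  have hmono : StrictMono (fun k => (F (s k)).2) :=
    strictMono_nat_of_lt_succ fun k => by
      have := hF3 (s (k + 1))
      rw [hs k] at this ⊢
      exact this
  obtain ⟨a, ha1, ha2⟩ := h _ hinj hne hdisj
  obtain ⟨M, hM⟩ := Filter.eventually_atTop.1 (hev a)
  obtain ⟨k, hk, hkM⟩ := ha1.exists_gt M
  obtain ⟨l, hl, hlM⟩ := ha2.exists_gt M
  have e1 := hM _ (hkM.le.trans (hmono.id_le k))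
  have e2 := hM _ (hlM.le.trans (hmono.id_le l))
  have k1 : (x (F (s k)).2).1 a = true := by
    have := (x (F (s k)).2).2.2.2.1 (F (s k)).1 a
    rw [inf_eq_left.2 hk, hF4] at this
    simpa using this.symm
  have l1 : (x (F (s l)).2).1 a = false := by
    have := (x (F (s l)).2).2.2.2.1 (F (s l)).1 a
    rw [show (F (s l)).1 ⊓ a = ⊥ from hl, hF4, (x _).2.2.1] at this
    simpa using this.symm
  have := k1.symm.trans (e1.trans (e2.symm.trans l1))
  exact Bool.noConfusion this
end

section
/- Let 𝒜 be an infinite Boolean algebra whose Stone space K_𝒜 has no nontrivial convergent sequence (every convergent sequence in K_𝒜 is eventually constant). Then 𝒜 contains a countably infinite independent family, i.e. there is an injective sequence (B_n)_{n∈ℕ} of elements of 𝒜 that is independent. -/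
namespace IndepAux

/-- Binary tree of elements built from a splitting function. -/
def U {A : Type*} [BooleanAlgebra A] (s : A → A) (F : Finset ℕ) : ℕ → A
  | 0 => ⊤
  | n + 1 => if n ∈ F then s (U s F n) else U s F n \ s (U s F n)

/-- The independent sequence. -/
def B {A : Type*} [BooleanAlgebra A] (s : A → A) (n : ℕ) : A :=
  (Finset.range n).powerset.sup (fun S => s (U s S n))

variable {A : Type*} [BooleanAlgebra A]

theorem U_congr (s : A → A) (F G : Finset ℕ) (n : ℕ) (h : ∀ i < n, (i ∈ F ↔ i ∈ G)) :
    U s F n = U s G n := by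
  induction n with
  | zero => rfl
  | succ n ih =>
    have h1 := ih (fun i hi => h i (by omega))
    have h2 := h n (by omega)
    simp only [U, h1, h2]

theorem U_succ_le (s : A → A) (hs : ∀ a, s a ≤ a) (F : Finset ℕ) (n : ℕ) :
    U s F (n + 1) ≤ U s F n := by
  simp only [U]
  split_ifs
  · exact hs _
  · exact sdiff_le

theorem U_anti (s : A → A) (hs : ∀ a, s a ≤ a) (F : Finset ℕ) : Antitone (U s F) :=
  antitone_nat_of_succ_le (U_succ_le s hs F)

theorem U_disj (s : A → A) (hs : ∀ a, s a ≤ a) (F G : Finset ℕ) (n : ℕ)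
    (h : ¬ ∀ i < n, (i ∈ F ↔ i ∈ G)) : Disjoint (U s F n) (U s G n) := by
  induction n with
  | zero => exact absurd (fun i hi => absurd hi (by omega)) h
  | succ n ih =>
    by_cases h1 : ∀ i < n, (i ∈ F ↔ i ∈ G)
    · have h2 : ¬ (n ∈ F ↔ n ∈ G) := by
        intro h2
        apply h
        intro i hi
        rcases Nat.lt_succ_iff_lt_or_eq.mp hi with h3 | rfl
        · exact h1 i h3
        · exact h2
      have e := U_congr s F G n h1
      simp only [U, e]
      by_cases hF : n ∈ F <;> by_cases hG : n ∈ G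
      · exact absurd (by simp [hF, hG]) h2
      · simp only [hF, hG, if_true, if_false]
        exact disjoint_sdiff_self_right
      · simp only [hF, hG, if_true, if_false]
        exact disjoint_sdiff_self_left
      · exact absurd (by simp [hF, hG]) h2
    · exact (ih h1).mono (U_succ_le s hs F n) (U_succ_le s hs G n)

theorem U_le_B (s : A → A) (F : Finset ℕ) (n : ℕ) (hn : n ∈ F) :
    U s F (n + 1) ≤ B s n := by
  have e : U s F n = U s (F ∩ Finset.range n) n :=
    U_congr s _ _ n (fun i hi => by simp [hi])
  simp only [U, hn, if_true, e]
  exact Finset.le_sup (f := fun S => s (U s S n)) (by simp)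

theorem U_disj_B (s : A → A) (hs : ∀ a, s a ≤ a) (F : Finset ℕ) (n : ℕ) (hn : n ∉ F) :
    Disjoint (U s F (n + 1)) (B s n) := by
  unfold B
  rw [Finset.disjoint_sup_right]
  intro S _
  by_cases h1 : ∀ i < n, (i ∈ F ↔ i ∈ S)
  · have e := U_congr s F S n h1
    simp only [U, hn, if_false, e]
    exact disjoint_sdiff_self_left
  · exact (U_disj s hs F S n h1).mono (U_succ_le s hs F n) (hs _)

theorem indep_of_split (P : A → Prop) (hbot : ¬ P ⊥) (htop : P ⊤)
    (hsplit : ∀ a, P a → ∃ b, b ≤ a ∧ P b ∧ P (a \ b)) :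
    ∃ B : ℕ → A, Function.Injective B ∧ IndepFamily B := by
  have hsp : ∀ a, ∃ b, b ≤ a ∧ (P a → P b ∧ P (a \ b)) := by
    intro a
    by_cases ha : P a
    · obtain ⟨b, h1, h2⟩ := hsplit a ha
      exact ⟨b, h1, fun _ => h2⟩
    · exact ⟨a, le_rfl, fun h => absurd h ha⟩
  choose s hs hP using hsp
  have hU : ∀ F n, P (U s F n) := by
    intro F n
    induction n with
    | zero => exact htop
    | succ n ih =>
      simp only [U]
      split_ifs
      · exact (hP _ ih).1
      · exact (hP _ ih).2
  have hind : IndepFamily (B s) := by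
    intro F G hFG h0
    obtain ⟨N, hN⟩ : ∃ N, ∀ i ∈ F ∪ G, i < N :=
      ⟨(F ∪ G).sup id + 1, fun i hi => Nat.lt_succ_of_le (Finset.le_sup (f := id) hi)⟩
    have hle : U s F N ≤ F.inf (B s) ⊓ G.inf fun i => (B s i)ᶜ := by
      refine le_inf (Finset.le_inf ?_) (Finset.le_inf ?_)
      · intro i hi
        exact (U_anti s hs F (hN i (by simp [hi]))).trans (U_le_B s F i hi)
      · intro i hi
        have : i ∉ F := fun h => Finset.disjoint_left.mp hFG h hi
        exact (U_anti s hs F (hN i (by simp [hi]))).trans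
          (U_disj_B s hs F i this).le_compl_right
    rw [h0, le_bot_iff] at hle
    exact hbot (hle ▸ hU F N)
  refine ⟨B s, ?_, hind⟩
  intro m n hmn
  by_contra hne
  apply hind {m} {n} (by simpa using hne)
  simp [hmn]

theorem fin_sup {a b : A} (ha : (Set.Iic a).Finite) (hb : (Set.Iic b).Finite) :
    (Set.Iic (a ⊔ b)).Finite := by
  refine ((ha.prod hb).image (fun p : A × A => p.1 ⊔ p.2)).subset ?_
  intro c hc
  refine ⟨(c ⊓ a, c ⊓ b), ⟨inf_le_right, inf_le_right⟩, ?_⟩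
  simp only [← inf_sup_left]
  exact inf_eq_left.mpr hc

theorem fin_mono {a b : A} (hab : a ≤ b) (hb : (Set.Iic b).Finite) : (Set.Iic a).Finite :=
  hb.subset (Set.Iic_subset_Iic.mpr hab)

theorem exists_atom {a : A} (ha : (Set.Iic a).Finite) (h0 : a ≠ ⊥) : ∃ c, IsAtom c ∧ c ≤ a := by
  have hfin : {c | c ≤ a ∧ c ≠ ⊥}.Finite := ha.subset (fun c hc => hc.1)
  obtain ⟨c, hc⟩ := hfin.exists_minimal ⟨a, le_rfl, h0⟩
  refine ⟨c, ⟨hc.prop.2, ?_⟩, hc.prop.1⟩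
  intro b hb
  by_contra hb0
  exact absurd (hc.le_of_le ⟨hb.le.trans hc.prop.1, hb0⟩ hb.le) (not_le_of_gt hb)

theorem atoms_infinite {a : A} (ha : ¬ (Set.Iic a).Finite)
    (hd : ∀ b, (Set.Iic (a ⊓ b)).Finite ∨ (Set.Iic (a \ b)).Finite) :
    {c | IsAtom c ∧ c ≤ a}.Infinite := by
  intro hS
  set t := hS.toFinset.sup id with ht
  have htI : (Set.Iic t).Finite := by
    rw [ht]
    refine Finset.sup_induction (p := fun x : A => (Set.Iic x).Finite) ?_ ?_ ?_
    · simp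
    · intro x hx y hy
      exact fin_sup hx hy
    · intro c hc
      have hc' : IsAtom c := by simpa using (hS.mem_toFinset.mp hc).1
      have : Set.Iic (id c) = {⊥, c} := by
        ext x
        simp [hc'.le_iff]
      rw [this]
      exact Set.toFinite _
  have hr : ¬ (Set.Iic (a \ t)).Finite := by
    intro h
    apply ha
    exact fin_mono (by rw [sdiff_sup_self]; exact le_sup_left) (fin_sup h htI)
  have hno : ∀ c, c ≤ a \ t → (Set.Iic c).Finite → c = ⊥ := by
    intro c hc hf
    by_contra h0
    obtain ⟨d, hd1, hd2⟩ := exists_atom hf h0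
    have h1 : d ≤ t := Finset.le_sup (f := id)
      (hS.mem_toFinset.mpr ⟨hd1, (hd2.trans hc).trans sdiff_le⟩)
    have h2 : Disjoint d d :=
      (disjoint_sdiff_self_left (x := t) (y := a)).mono (hd2.trans hc) h1
    exact hd1.1 (disjoint_self.mp h2)
  apply hr
  refine (Set.toFinite {⊥, a \ t}).subset ?_
  intro b hb
  have hb' : b ≤ a \ t := hb
  rcases hd b with h | h
  · left
    apply hno b hb'
    rwa [inf_eq_right.mpr (hb'.trans sdiff_le)] at h
  · right
    have h3 := hno ((a \ t) \ b) sdiff_le (fin_mono (sdiff_le_sdiff_right sdiff_le) h)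
    exact le_antisymm hb' (sdiff_eq_bot_iff.mp h3)

end IndepAux

open IndepAux in
open Classical in
/-- If the Stone space of an infinite Boolean algebra has no nontrivial convergent
sequences, then the algebra contains a countably infinite independent family. -/
theorem exists_countable_indep_of_no_convergent_sequences (A : Type*) [BooleanAlgebra A]
    [Infinite A]
    (h : ∀ (x : ℕ → StoneSpace A) (p : StoneSpace A),
      Filter.Tendsto x Filter.atTop (nhds p) → ∃ N : ℕ, ∀ n : ℕ, N ≤ n → x n = x N) :
    ∃ B : ℕ → A, Function.Injective B ∧ IndepFamily B := by
  by_cases hsplit : ∀ a : A, ¬ (Set.Iic a).Finite →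
      ∃ b, b ≤ a ∧ ¬ (Set.Iic b).Finite ∧ ¬ (Set.Iic (a \ b)).Finite
  · refine indep_of_split (fun a : A => ¬ (Set.Iic a).Finite) (by simp) ?_ hsplit
    simpa using Set.infinite_univ (α := A)
  exfalso
  push Not at hsplit
  obtain ⟨a, ha, hd'⟩ := hsplit
  have hd : ∀ b, (Set.Iic (a ⊓ b)).Finite ∨ (Set.Iic (a \ b)).Finite := by
    intro b
    by_contra! hc
    have := hd' (a ⊓ b) inf_le_left hc.1
    rw [sdiff_inf_self_left] at this
    exact hc.2 this
  have ha' : ∀ b, (Set.Iic (a ⊓ b)).Finite → (Set.Iic (a \ b)).Finite → False := by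
    intro b h1 h2
    apply ha
    have := fin_sup h1 h2
    rwa [sup_comm, sup_sdiff_inf] at this
  have hS := atoms_infinite ha hd
  let c : ℕ ↪ {c | IsAtom c ∧ c ≤ a} := hS.natEmbedding
  have hat : ∀ n, IsAtom (c n : A) := fun n => (c n).2.1
  have hca : ∀ n, (c n : A) ≤ a := fun n => (c n).2.2
  have hcinj : Function.Injective (fun n => (c n : A)) :=
    Subtype.val_injective.comp c.injective
  have hdisj : ∀ n (b : A), ¬ (c n : A) ≤ b → Disjoint (c n : A) b := by
    intro n b hb
    rw [disjoint_iff]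
    rcases (hat n).le_iff.mp (inf_le_left : (c n : A) ⊓ b ≤ c n) with h1 | h1
    · exact h1
    · exact absurd (inf_eq_left.mp h1) hb
  let x : ℕ → StoneSpace A := fun n => ⟨fun b => decide ((c n : A) ≤ b), by
    refine ⟨by simp, by simpa using (hat n).1, ?_, ?_⟩
    · intro u v
      simp [Bool.decide_and]
    · intro u v
      have : (c n : A) ≤ u ⊔ v ↔ (c n : A) ≤ u ∨ (c n : A) ≤ v := by
        refine ⟨fun h1 => ?_, fun h1 => h1.elim le_sup_of_le_left le_sup_of_le_right⟩
        by_contra! hc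
        exact hc.2 ((hdisj n u hc.1).left_le_of_le_sup_left h1)
      simp [this, Bool.decide_or]⟩
  let p : StoneSpace A := ⟨fun b => decide ((Set.Iic (a \ b)).Finite), by
    refine ⟨by simp, by simpa using ha, ?_, ?_⟩
    · intro u v
      rw [← Bool.decide_and, decide_eq_decide, sdiff_inf]
      exact ⟨fun h => ⟨fin_mono le_sup_left h, fin_mono le_sup_right h⟩,
        fun h => fin_sup h.1 h.2⟩
    · intro u v
      rw [← Bool.decide_or, decide_eq_decide]
      constructor
      · intro h
        by_contra! hc
        have h1 := (hd u).resolve_right hc.1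
        have h2 := (hd v).resolve_right hc.2
        refine ha' (u ⊔ v) ?_ h
        rw [inf_sup_left]
        exact fin_sup h1 h2
      · rintro (h | h)
        · exact fin_mono (sdiff_le_sdiff_left le_sup_left) h
        · exact fin_mono (sdiff_le_sdiff_left le_sup_right) h⟩
  have hlim : Filter.Tendsto x Filter.atTop (nhds p) := by
    refine tendsto_subtype_rng.mpr ?_
    rw [tendsto_pi_nhds]
    intro b
    apply tendsto_nhds_of_eventually_eq
    rw [← Nat.cofinite_eq_atTop]
    have key : ∀ d : A, (Set.Iic d).Finite → {n | (c n : A) ≤ d}.Finite := fun d hdf =>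
      Set.Finite.preimage (f := fun n => (c n : A)) hcinj.injOn hdf
    by_cases hb : (Set.Iic (a \ b)).Finite
    · refine (key _ hb).subset ?_
      intro n hn
      have hn' : ¬ ((c n : A) ≤ b) := by
        intro h1
        apply hn
        simp [x, p, hb, h1]
      have : Disjoint (c n : A) b := hdisj n b hn'
      exact le_sdiff.mpr ⟨hca n, this⟩
    · refine (key _ ((hd b).resolve_right hb)).subset ?_
      intro n hn
      have hn' : (c n : A) ≤ b := by
        by_contra h1
        apply hn
        simp [x, p, hb, h1]
      exact le_inf (hca n) hn'
  obtain ⟨N, hN⟩ := h x p hlim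
  have h1 := congrFun (congrArg Subtype.val (hN (N + 1) (by omega))) (c N : A)
  have h2 : (c (N + 1) : A) ≤ c N := by simpa [x] using h1
  have h3 : (c (N + 1) : A) = c N := ((hat N).le_iff.mp h2).resolve_left (hat (N + 1)).1
  have := hcinj h3
  omega
end

section
/- Let 𝒜 be a Boolean algebra containing a countably infinite independent family. Then there exists a family (A_s)_{s ∈ {0,1}^{<ℕ}} of elements of 𝒜, indexed by finite 0–1 sequences, such that: (i) A_s ⊓ A_t = 0 whenever s is a proper initial segment of t; and (ii) for every finite list u_1, …, u_n of finite 0–1 sequences none of which is an initial segment of another, the meet A_{u_1} ⊓ ⋯ ⊓ A_{u_n} is nonzero. In particular, each A_s is nonzero. -/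
/-- In a Boolean algebra containing a countably infinite independent family there is a
family `(A_s)` indexed by finite 0-1 sequences such that `A_s ⊓ A_t = ⊥` whenever `s` is a
proper initial segment of `t`, while the meet of `A_{u_1}, …, A_{u_n}` is nonzero whenever
none of the `u_i` is an initial segment of another; in particular each `A_s` is nonzero. -/
theorem exists_tree_family_of_indep (A : Type*) [BooleanAlgebra A]
    (g : ℕ → A) (hg : Function.Injective g) (hind : IndepFamily g) :
    ∃ As : List Bool → A,
      (∀ s t : List Bool, s <+: t → s ≠ t → As s ⊓ As t = ⊥) ∧
      (∀ (n : ℕ) (u : Fin (n + 1) → List Bool),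
        (∀ i j, i ≠ j → ¬ u i <+: u j) →
        Finset.univ.inf (fun i => As (u i)) ≠ ⊥) ∧
      (∀ s : List Bool, As s ≠ ⊥) := by
  classical
  let e : List Bool → ℕ := Encodable.encode
  have he : Function.Injective e := Encodable.encode_injective
  let P : List Bool → Finset ℕ := fun s => (s.inits.toFinset.erase s).image e
  have hP : ∀ s t : List Bool, e t ∈ P s ↔ t ≠ s ∧ t <+: s := by
    intro s t
    simp only [P, Finset.mem_image, Finset.mem_erase, List.mem_toFinset, List.mem_inits]
    constructor
    · rintro ⟨a, ha, hat⟩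
      rw [← he hat]
      exact ha
    · intro h
      exact ⟨t, h, rfl⟩
  let As : List Bool → A := fun s => g (e s) ⊓ (P s).inf fun i => (g i)ᶜ
  have key : ∀ (n : ℕ) (u : Fin (n + 1) → List Bool),
        (∀ i j, i ≠ j → ¬ u i <+: u j) →
        Finset.univ.inf (fun i => As (u i)) ≠ ⊥ := by
    intro n u hu hbot
    refine hind (Finset.univ.image fun i => e (u i)) (Finset.univ.biUnion fun i => P (u i)) ?_ ?_
    · rw [Finset.disjoint_left]
      intro a ha hb
      simp only [Finset.mem_image, Finset.mem_biUnion, Finset.mem_univ, true_and] at ha hb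
      obtain ⟨i, rfl⟩ := ha
      obtain ⟨j, hj⟩ := hb
      rw [hP] at hj
      by_cases hij : i = j
      · exact hj.1 (by rw [hij])
      · exact hu i j hij hj.2
    · rw [← le_bot_iff, ← hbot]
      refine Finset.le_inf fun i _ => inf_le_inf ?_ ?_
      · exact Finset.inf_le (f := g) (Finset.mem_image_of_mem (fun i => e (u i)) (Finset.mem_univ i))
      · exact Finset.inf_mono (Finset.subset_biUnion_of_mem (fun i => P (u i)) (Finset.mem_univ i))
  refine ⟨As, ?_, key, ?_⟩
  · intro s t hst hne
    rw [← le_bot_iff, ← inf_compl_eq_bot (a := g (e s))]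
    refine inf_le_inf inf_le_left (inf_le_right.trans ?_)
    exact Finset.inf_le (f := fun i => (g i)ᶜ) ((hP t s).2 ⟨hne, hst⟩)
  · intro s hs
    refine key 0 (fun _ => s) (fun i j hij => absurd (Fin.ext (by omega)) hij) ?_
    simpa using hs
end

section
/- Let 𝒜 be a Boolean algebra and (A_s)_{s ∈ {0,1}^{<ℕ}} a family of elements of 𝒜 such that for every finite list u_1, …, u_n of finite 0–1 sequences none of which is an initial segment of another, the meet A_{u_1} ⊓ ⋯ ⊓ A_{u_n} is nonzero. Suppose that for each x ∈ 2^ℕ an element A_x ∈ 𝒜 is given such that both sets {m ∈ ℕ : A_{x↾m} ≤ A_x} and {m ∈ ℕ : A_{x↾m} ⊓ A_x = 0} are infinite (where x↾m denotes the initial segment of x of length m). Then the family (A_x)_{x ∈ 2^ℕ} is independent; in particular the map x ↦ A_x is injective, so 𝒜 contains an independent family of cardinality continuum. -/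
/-- Given a tree-indexed family `(A_s)_{s ∈ {0,1}^{<ℕ}}` whose meets along pairwise
incomparable finite 0-1 sequences are nonzero, and for each `x ∈ 2^ℕ` an element `A_x`
such that `{m | A_{x↾m} ≤ A_x}` and `{m | A_{x↾m} ⊓ A_x = ⊥}` are both infinite, the
family `(A_x)_{x ∈ 2^ℕ}` is independent and the map `x ↦ A_x` is injective, so that the
algebra contains an independent family of cardinality continuum. -/
theorem indepFamily_of_separating_elements (A : Type*) [BooleanAlgebra A]
    (As : List Bool → A)
    (hAs : ∀ (n : ℕ) (u : Fin (n + 1) → List Bool),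
      (∀ i j, i ≠ j → ¬ u i <+: u j) →
      Finset.univ.inf (fun i => As (u i)) ≠ ⊥)
    (Ax : (ℕ → Bool) → A)
    (hAx : ∀ x : ℕ → Bool,
      {m : ℕ | As (List.ofFn fun i : Fin m => x i) ≤ Ax x}.Infinite ∧
      {m : ℕ | As (List.ofFn fun i : Fin m => x i) ⊓ Ax x = ⊥}.Infinite) :
    IndepFamily Ax ∧ Function.Injective Ax := by
  classical
  have key : IndepFamily Ax := by
    intro F G hFG hbot
    have hd : ∀ x y : ℕ → Bool, ∃ d : ℕ, x ≠ y → x d ≠ y d := by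
      intro x y
      by_cases h : x = y
      · exact ⟨0, fun h' => absurd h h'⟩
      · obtain ⟨d, hd⟩ := Function.ne_iff.mp h
        exact ⟨d, fun _ => hd⟩
    choose d hd using hd
    let S : Finset (ℕ → Bool) := insert (fun _ => false) (F ∪ G)
    let N : ℕ := S.sup fun x => S.sup fun y => d x y
    have hN : ∀ x ∈ S, ∀ y ∈ S, d x y ≤ N := fun x hx y hy =>
      (Finset.le_sup (f := fun y => d x y) hy).trans
        (Finset.le_sup (f := fun x => S.sup fun y => d x y) hx)
    have hm : ∀ x : ℕ → Bool, ∃ m : ℕ, N < m ∧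
        (x ∈ F → As (List.ofFn fun i : Fin m => x i) ≤ Ax x) ∧
        (x ∈ G → As (List.ofFn fun i : Fin m => x i) ≤ (Ax x)ᶜ) := by
      intro x
      by_cases hx : x ∈ F
      · obtain ⟨m, h1, h2⟩ := (hAx x).1.exists_gt N
        exact ⟨m, h2, fun _ => h1,
          fun hG => absurd hG (Finset.disjoint_left.mp hFG hx)⟩
      · obtain ⟨m, h1, h2⟩ := (hAx x).2.exists_gt N
        exact ⟨m, h2, fun h => absurd h hx,
          fun _ => le_compl_iff_disjoint_right.mpr (disjoint_iff.mpr h1)⟩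
    choose m hmN hmF hmG using hm
    have hcard : S.card = (S.card - 1) + 1 := by
      have : 0 < S.card := Finset.card_pos.mpr ⟨_, Finset.mem_insert_self _ _⟩
      omega
    let e : S ≃ Fin ((S.card - 1) + 1) := S.equivFinOfCardEq hcard
    refine hAs (S.card - 1)
      (fun i => List.ofFn fun k : Fin (m (e.symm i).1) => (e.symm i).1 k) ?_ ?_
    · intro i j hij hpre
      have hne : (e.symm i).1 ≠ (e.symm j).1 := fun h =>
        hij (e.symm.injective (Subtype.ext h))
      have hlt := hN _ (e.symm i).2 _ (e.symm j).2
      have h1 : d (e.symm i).1 (e.symm j).1 < m (e.symm i).1 := hlt.trans_lt (hmN _)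
      have := hpre.getElem (i := d (e.symm i).1 (e.symm j).1) (by simpa using h1)
      simp only [List.getElem_ofFn] at this
      exact hd _ _ hne this
    · rw [eq_bot_iff, ← hbot]
      have hle : ∀ x (hx : x ∈ S), Finset.univ.inf (fun i => As
          (List.ofFn fun k : Fin (m (e.symm i).1) => (e.symm i).1 k)) ≤
          As (List.ofFn fun k : Fin (m x) => x k) := by
        intro x hx
        obtain ⟨i, hi⟩ := e.symm.surjective ⟨x, hx⟩
        obtain rfl : (e.symm i).1 = x := congrArg Subtype.val hi
        exact Finset.inf_le (f := fun i => As
          (List.ofFn fun k : Fin (m (e.symm i).1) => (e.symm i).1 k)) (Finset.mem_univ i)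
      refine le_inf (Finset.le_inf fun x hx => ?_) (Finset.le_inf fun x hx => ?_)
      · exact (hle x (by simp [S, hx])).trans (hmF x hx)
      · exact (hle x (by simp [S, hx])).trans (hmG x hx)
  refine ⟨key, fun x y hxy => ?_⟩
  by_contra hne
  apply key {x} {y} (by simpa using hne)
  simp [hxy]
end

section
/- Let 𝒜 be a Boolean algebra containing an independent family of cardinality continuum (an injective independent family indexed by 2^ℕ). Then the Stone space K_𝒜 of 𝒜 contains a homeomorphic copy of the Čech–Stone compactification βℕ of the natural numbers; that is, there is a topological embedding of βℕ into K_𝒜. -/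
theorem stoneSpace_compact (A : Type*) [BooleanAlgebra A] : CompactSpace (StoneSpace A) := by
  have : IsClosed {x : A → Bool | IsBoolHom x} := by
    have e : {x : A → Bool | IsBoolHom x} = {x | x ⊤ = true} ∩ ({x | x ⊥ = false} ∩
        ((⋂ a, ⋂ b, {x | x (a ⊓ b) = (x a && x b)}) ∩
        (⋂ a, ⋂ b, {x | x (a ⊔ b) = (x a || x b)}))) := by
      ext x; simp [IsBoolHom]
    rw [e]
    have c : ∀ a : A, Continuous fun x : A → Bool => x a := fun a => continuous_apply a
    have h2 : ∀ (f : Bool → Bool → Bool) (a b : A),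
        Continuous fun x : A → Bool => f (x a) (x b) := fun f a b =>
      (continuous_of_discreteTopology (f := fun p : Bool × Bool => f p.1 p.2)).comp
        ((c a).prodMk (c b))
    refine (isClosed_eq (c _) continuous_const).inter
      ((isClosed_eq (c _) continuous_const).inter (IsClosed.inter ?_ ?_))
    · exact isClosed_iInter fun a => isClosed_iInter fun b => isClosed_eq (c _) (h2 and a b)
    · exact isClosed_iInter fun a => isClosed_iInter fun b => isClosed_eq (c _) (h2 or a b)
  exact isCompact_iff_compactSpace.mp this.isCompact

theorem stoneSpace_t2 (A : Type*) [BooleanAlgebra A] : T2Space (StoneSpace A) :=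
  inferInstanceAs (T2Space {x : A → Bool // IsBoolHom x})

theorem stoneSpace_eval (A : Type*) [BooleanAlgebra A] (a : A) :
    Continuous (fun x : StoneSpace A => x.1 a) :=
  (continuous_apply a).comp continuous_subtype_val

theorem exists_point {I A : Type*} [BooleanAlgebra A] (g : I → A) (hind : IndepFamily g)
    (v : I → Bool) : ∃ x : StoneSpace A, ∀ i, x.1 (g i) = v i := by
  classical
  let k : I → A := fun i => if v i then g i else (g i)ᶜ
  have hk : ∀ T : Finset I, T.inf k ≠ ⊥ := by
    intro T h
    apply hind (T.filter (fun i => v i = true)) (T.filter (fun i => ¬ v i = true))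
      (Finset.disjoint_filter_filter_not _ _ _)
    rw [eq_bot_iff, ← h]
    refine Finset.le_inf fun i hi => ?_
    by_cases hv : v i = true
    · simp only [k, hv, if_true]
      exact inf_le_left.trans (Finset.inf_le (by simp [hi, hv]))
    · simp only [k, hv, if_false]
      exact inf_le_right.trans
        (Finset.inf_le (f := fun i => (g i)ᶜ) (Finset.mem_filter.2 ⟨hi, hv⟩))
  have hF : Order.IsPFilter {a : A | ∃ T : Finset I, T.inf k ≤ a} := by
    refine Order.IsPFilter.of_def ⟨⊤, ∅, le_top⟩ ?_ ?_
    · rintro a ⟨S, hS⟩ b ⟨T, hT⟩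
      refine ⟨a ⊓ b, ⟨S ∪ T, ?_⟩, inf_le_left, inf_le_right⟩
      rw [Finset.inf_union]
      exact inf_le_inf hS hT
    · rintro a b hab ⟨S, hS⟩
      exact ⟨S, hS.trans hab⟩
  obtain ⟨J, hJ, -, hd⟩ := DistribLattice.prime_ideal_of_disjoint_filter_ideal
    (F := hF.toPFilter) (I := (⊥ : Order.Ideal A)) (by
      rw [Set.disjoint_left]
      rintro a ⟨T, hT⟩ ha
      have ha : a ≤ ⊥ := ha
      exact hk T (le_bot_iff.1 (hT.trans ha)))
  have hn : ∀ a : A, (∃ T : Finset I, T.inf k ≤ a) → a ∉ J := fun a ha hj =>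
    Set.disjoint_left.1 hd ha hj
  have hkJ : ∀ i, k i ∉ J := fun i => hn _ ⟨{i}, by simp⟩
  refine ⟨⟨fun a => decide (a ∉ J), ?_, ?_, ?_, ?_⟩, ?_⟩
  · simpa using hn ⊤ ⟨∅, le_top⟩
  · simp
  · intro a b
    have : a ⊓ b ∈ J ↔ a ∈ J ∨ b ∈ J :=
      ⟨hJ.mem_or_mem, fun h => h.elim (J.lower inf_le_left) (J.lower inf_le_right)⟩
    simp [this]
  · intro a b
    have : a ⊔ b ∈ J ↔ a ∈ J ∧ b ∈ J := Order.Ideal.sup_mem_iff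
    simp only [this]
    by_cases a ∈ J <;> by_cases b ∈ J <;> simp [*]
  · intro i
    have h := hkJ i
    by_cases hv : v i = true
    · simp only [k, hv, if_true] at h
      simp [h, hv]
    · simp only [k, hv] at h
      have : g i ∈ J := (hJ.mem_or_compl_mem (x := g i)).resolve_right h
      simp [this, hv]

/-- If a Boolean algebra contains an independent family of cardinality continuum, then
its Stone space contains a homeomorphic copy of the Čech-Stone compactification `βℕ`. -/
theorem stoneCech_embeds_of_indep_continuum (A : Type*) [BooleanAlgebra A]
    (g : (ℕ → Bool) → A) (hg : Function.Injective g) (hind : IndepFamily g) :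
    ∃ e : StoneCech ℕ → StoneSpace A, Topology.IsEmbedding e := by
  classical
  have := stoneSpace_compact A
  have := stoneSpace_t2 A
  choose x hx using fun n : ℕ => exists_point g hind (fun s => s n)
  have hxc : Continuous x := continuous_of_discreteTopology
  have hc := continuous_stoneCechExtend hxc
  refine ⟨stoneCechExtend hxc, (hc.isClosedEmbedding ?_).isEmbedding⟩
  intro p q hpq
  by_contra hne
  obtain ⟨U, V, hU, hV, hp, hq, hUV⟩ := t2_separation hne
  let s : ℕ → Bool := fun n => decide (stoneCechUnit n ∈ U)
  let h : StoneCech ℕ → Bool := fun y => (stoneCechExtend hxc y).1 (g s)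
  have hh : Continuous h := (stoneSpace_eval A (g s)).comp hc
  have hu : ∀ n, h (stoneCechUnit n) = s n := fun n => by
    simp only [h, stoneCechExtend_stoneCechUnit, hx]
  have key : ∀ (b : Bool) (W : Set (StoneCech ℕ)), IsOpen W → ∀ y ∈ W, h y = b →
      ∃ n, stoneCechUnit n ∈ W ∧ s n = b := by
    intro b W hW y hy hb
    obtain ⟨n, hn⟩ := denseRange_stoneCechUnit.exists_mem_open
      (hW.inter ((isOpen_discrete {b}).preimage hh)) ⟨y, hy, hb⟩
    exact ⟨n, hn.1, (hu n).symm.trans hn.2⟩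
  have hpq' : h p = h q := by simp only [h, hpq]
  cases hb : h p
  · obtain ⟨n, hn, hs⟩ := key _ U hU p hp hb
    simp [s, hn] at hs
  · obtain ⟨n, hn, hs⟩ := key _ V hV q hq (hpq' ▸ hb)
    exact Set.disjoint_left.1 hUV (by simpa [s] using hs) hn
end

section
/- Let 𝒜 be an infinite Boolean algebra with the weak subsequential separation property. Then the Stone space K_𝒜 of 𝒜 contains a homeomorphic copy of βℕ, the Čech–Stone compactification of the natural numbers. -/
namespace WSS

open Topology

variable {A : Type*} [BooleanAlgebra A]

theorem map_inf_iff (φ : StoneSpace A) (a b : A) :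
    φ.1 (a ⊓ b) = true ↔ φ.1 a = true ∧ φ.1 b = true := by
  rw [φ.2.2.2.1 a b]; simp

theorem map_sup_iff (φ : StoneSpace A) (a b : A) :
    φ.1 (a ⊔ b) = true ↔ φ.1 a = true ∨ φ.1 b = true := by
  rw [φ.2.2.2.2 a b]; simp

theorem map_compl_iff (φ : StoneSpace A) (a : A) :
    φ.1 aᶜ = true ↔ ¬ φ.1 a = true := by
  have h1 := map_inf_iff φ a aᶜ
  have h2 := map_sup_iff φ a aᶜ
  rw [inf_compl_self, φ.2.2.1] at h1
  rw [sup_compl_eq_top, φ.2.1] at h2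
  simp only [Bool.false_eq_true, false_iff, true_iff] at h1 h2
  tauto

theorem map_sdiff_iff (φ : StoneSpace A) (a b : A) :
    φ.1 (a \ b) = true ↔ φ.1 a = true ∧ ¬ φ.1 b = true := by
  rw [sdiff_eq, map_inf_iff, map_compl_iff]

theorem map_mono (φ : StoneSpace A) {a b : A} (hab : a ≤ b) (ha : φ.1 a = true) :
    φ.1 b = true := by
  rw [← inf_eq_left.2 hab, map_inf_iff] at ha
  exact ha.2

theorem map_ne_bot (φ : StoneSpace A) {a : A} (ha : φ.1 a = true) : a ≠ ⊥ := by
  rintro rfl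
  rw [φ.2.2.1] at ha
  exact Bool.false_ne_true ha

theorem map_finset_sup_iff {ι : Type*} (φ : StoneSpace A) (s : Finset ι) (f : ι → A) :
    φ.1 (s.sup f) = true ↔ ∃ i ∈ s, φ.1 (f i) = true := by
  classical
  induction s using Finset.induction_on with
  | empty => simp [φ.2.2.1]
  | insert i s hi ih => rw [Finset.sup_insert, map_sup_iff, ih]; simp

theorem exists_point {a : A} (ha : a ≠ ⊥) : ∃ φ : StoneSpace A, φ.1 a = true := by
  classical
  obtain ⟨J, hJ, -, hd⟩ := DistribLattice.prime_ideal_of_disjoint_filter_ideal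
    (F := Order.PFilter.principal a) (I := Order.Ideal.principal (⊥ : A)) (by
      rw [Set.disjoint_left]
      intro b hb hb'
      have h1 : a ≤ b := hb
      have h2 : b ≤ ⊥ := hb'
      exact ha (le_bot_iff.1 (h1.trans h2)))
  refine ⟨⟨fun b => decide (b ∉ J), ?_, ?_, ?_, ?_⟩, ?_⟩
  · simpa using hJ.top_notMem
  · simp
  · intro b c
    have : b ⊓ c ∈ J ↔ b ∈ J ∨ c ∈ J :=
      ⟨fun h => hJ.mem_or_mem h, fun h => h.elim (fun h => J.lower inf_le_left h)
        (fun h => J.lower inf_le_right h)⟩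
    by_cases hb : b ∈ J <;> by_cases hc : c ∈ J <;> simp [this, hb, hc]
  · intro b c
    have : b ⊔ c ∈ J ↔ b ∈ J ∧ c ∈ J := Order.Ideal.sup_mem_iff
    by_cases hb : b ∈ J <;> by_cases hc : c ∈ J <;> simp [this, hb, hc]
  · have : a ∉ J := fun h => Set.disjoint_left.1 hd (show a ≤ a from le_rfl) h
    simpa using this

theorem continuous_eval (a : A) : Continuous (fun φ : StoneSpace A => φ.1 a) :=
  (continuous_apply a).comp continuous_subtype_val

instance : T2Space (StoneSpace A) :=
  inferInstanceAs (T2Space {x : A → Bool // IsBoolHom x})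

instance : CompactSpace (StoneSpace A) := by
  have : IsClosed {x : A → Bool | IsBoolHom x} := by
    have e : ∀ a : A, Continuous (fun x : A → Bool => x a) := fun a => continuous_apply a
    have c2 : ∀ (g : Bool → Bool → Bool) (a b : A),
        Continuous (fun x : A → Bool => g (x a) (x b)) := fun g a b =>
      (continuous_of_discreteTopology (f := fun p : Bool × Bool => g p.1 p.2)).comp
        ((e a).prodMk (e b))
    unfold IsBoolHom
    simp only [Set.ofPred_and, Set.ofPred_forall]
    refine (isClosed_eq (e _) continuous_const).inter
      ((isClosed_eq (e _) continuous_const).inter (IsClosed.inter ?_ ?_))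
    · exact isClosed_iInter fun a => isClosed_iInter fun b =>
        isClosed_eq (e _) (c2 (fun p q => p && q) a b)
    · exact isClosed_iInter fun a => isClosed_iInter fun b =>
        isClosed_eq (e _) (c2 (fun p q => p || q) a b)
  exact isCompact_iff_compactSpace.1 this.isCompact

theorem exists_point_of_finite {ι : Type*} (a : ι → A) (σ : ι → Bool)
    (H : ∀ t : Finset ι, ∃ φ : StoneSpace A, ∀ i ∈ t, φ.1 (a i) = σ i) :
    ∃ φ : StoneSpace A, ∀ i, φ.1 (a i) = σ i := by
  obtain ⟨φ, hφ⟩ := CompactSpace.iInter_nonempty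
    (t := fun i => {φ : StoneSpace A | φ.1 (a i) = σ i})
    (fun i => isClosed_eq (continuous_eval _) continuous_const) (by
      intro t
      obtain ⟨φ, hφ⟩ := H t
      exact ⟨φ, by simpa using hφ⟩)
  exact ⟨φ, by simpa using hφ⟩

/-- There is a disjoint sequence of nonzero elements below `a`. -/
def HasSeq (a : A) : Prop :=
  ∃ f : ℕ → A, (∀ n, f n ≠ ⊥) ∧ (∀ m n, m ≠ n → f m ⊓ f n = ⊥) ∧ ∀ n, f n ≤ a

theorem injective_of_disjoint {f : ℕ → A} (h0 : ∀ n, f n ≠ ⊥)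
    (hd : ∀ m n, m ≠ n → f m ⊓ f n = ⊥) : Function.Injective f := by
  intro m n hmn
  by_contra hne
  have := hd m n hne
  rw [hmn, inf_idem] at this
  exact h0 n this

theorem hasSeq_of_infinite {f : ℕ → A} (h0 : ∀ n, f n ≠ ⊥)
    (hd : ∀ m n, m ≠ n → f m ⊓ f n = ⊥) {a : A} (hi : {n | f n ≤ a}.Infinite) : HasSeq a := by
  let g := hi.natEmbedding
  refine ⟨fun n => f (g n), fun n => h0 _, fun m n hmn => hd _ _ ?_, fun n => (g n).2⟩
  intro h
  exact hmn (g.injective (Subtype.ext h))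

theorem HasSeq.split (h : WeakSubseqSep A) {a : A} (ha : HasSeq a) :
    ∃ c, HasSeq (a ⊓ c) ∧ HasSeq (a \ c) := by
  obtain ⟨f, h0, hd, hle⟩ := ha
  obtain ⟨c, h1, h2⟩ := h f (injective_of_disjoint h0 hd) h0 hd
  refine ⟨c, hasSeq_of_infinite h0 hd (h1.mono ?_), hasSeq_of_infinite h0 hd (h2.mono ?_)⟩
  · intro n hn
    exact le_inf (hle n) hn
  · intro n hn
    exact le_sdiff.2 ⟨hle n, disjoint_iff.2 hn⟩

theorem infinite_step {a : A} (ha : (Set.Iic a).Infinite) :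
    ∃ b, b < a ∧ (Set.Iic b).Infinite := by
  by_contra! hcon
  have hfin : ∀ b, b < a → (Set.Iic b).Finite := fun b hb => by
    simpa [Set.not_infinite] using hcon b hb
  obtain ⟨b, hb, hb'⟩ := ha.exists_notMem_finite (Set.toFinite ({⊥, a} : Set A))
  simp only [Set.mem_insert_iff, Set.mem_singleton_iff, not_or] at hb'
  have hba : b ≤ a := hb
  have h1 : (Set.Iic b).Finite := hfin b (lt_of_le_of_ne hba hb'.2)
  have h2 : (Set.Iic (a \ b)).Finite := hfin _ (sdiff_lt hba hb'.1)
  refine ha (((h1.prod h2).image (fun p : A × A => p.1 ⊔ p.2)).subset ?_)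
  intro c hc
  have hc' : c ≤ a := hc
  refine ⟨(c ⊓ b, c \ b), ⟨?_, ?_⟩, ?_⟩
  · exact (inf_le_right : c ⊓ b ≤ b)
  · exact (sdiff_le_sdiff_right hc' : c \ b ≤ a \ b)
  · exact sup_inf_sdiff c b

theorem hasSeq_top [Infinite A] : HasSeq (⊤ : A) := by
  have hT : (Set.Iic (⊤ : A)).Infinite := by
    rw [Set.Iic_top]; exact Set.infinite_univ
  choose g hg1 hg2 using fun a : {a : A // (Set.Iic a).Infinite} => infinite_step a.2
  let s : ℕ → {a : A // (Set.Iic a).Infinite} :=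
    fun n => Nat.rec ⟨⊤, hT⟩ (fun _ p => ⟨g p, hg2 p⟩) n
  have hs : ∀ n, (s (n + 1)).1 < (s n).1 := fun n => hg1 (s n)
  have hanti : Antitone fun n => (s n).1 := antitone_nat_of_succ_le fun n => (hs n).le
  have key : ∀ m n, m < n →
      ((s m).1 \ (s (m + 1)).1) ⊓ ((s n).1 \ (s (n + 1)).1) = ⊥ := by
    intro m n hmn
    have h1 : (s n).1 \ (s (n + 1)).1 ≤ (s (m + 1)).1 := sdiff_le.trans (hanti hmn)
    exact disjoint_iff.1 (disjoint_sdiff_self_left.mono_right h1)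
  refine ⟨fun n => (s n).1 \ (s (n + 1)).1, ?_, ?_, fun n => le_top⟩
  · intro n hn
    exact (hs n).not_ge (sdiff_eq_bot_iff.1 hn)
  · intro m n hmn
    rcases lt_or_gt_of_ne hmn with h | h
    · exact key m n h
    · rw [inf_comm]; exact key n m h

/-- The reversed initial segment of length `n` of `σ`. -/
def seg (σ : ℕ → Bool) : ℕ → List Bool
  | 0 => []
  | n + 1 => σ n :: seg σ n

theorem seg_length (σ : ℕ → Bool) (n : ℕ) : (seg σ n).length = n := by
  induction n with
  | zero => rfl
  | succ n ih => simp [seg, ih]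

theorem seg_agree {x y : ℕ → Bool} {n : ℕ} (h : seg x n = seg y n) : ∀ i < n, x i = y i := by
  induction n with
  | zero => intro i hi; omega
  | succ n ih =>
    simp only [seg, List.cons.injEq] at h
    intro i hi
    rcases Nat.lt_succ_iff_lt_or_eq.1 hi with h' | rfl
    · exact ih h.2 i h'
    · exact h.1

theorem exists_tree [Infinite A] (h : WeakSubseqSep A) :
    ∃ b c : List Bool → A, (∀ s, b s ≠ ⊥) ∧ (∀ s, b (true :: s) = b s ⊓ c s) ∧
      ∀ s, b (false :: s) = b s \ c s := by
  choose g hg1 hg2 using fun a : {a : A // HasSeq a} => HasSeq.split h a.2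
  let b : List Bool → {a : A // HasSeq a} := fun s =>
    List.rec ⟨⊤, hasSeq_top⟩
      (fun i _ p => if i = true then ⟨p.1 ⊓ g p, hg1 p⟩ else ⟨p.1 \ g p, hg2 p⟩) s
  refine ⟨fun s => (b s).1, fun s => g (b s), ?_, ?_, ?_⟩
  · intro s hs
    obtain ⟨f, h0, -, hle⟩ := (b s).2
    have := hle 0
    rw [show (b s).1 = ⊥ from hs] at this
    exact h0 0 (le_bot_iff.1 this)
  · intro s
    simp [b]
  · intro s
    simp [b]

theorem exists_indep_nat [Infinite A] (h : WeakSubseqSep A) :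
    ∃ a : ℕ → A, ∀ σ : ℕ → Bool, ∃ φ : StoneSpace A, ∀ n, φ.1 (a n) = σ n := by
  obtain ⟨b, c, hb, h1, h0⟩ := exists_tree h
  have uniq : ∀ (φ : StoneSpace A) (s s' : List Bool), s.length = s'.length →
      φ.1 (b s) = true → φ.1 (b s') = true → s = s' := by
    intro φ s
    induction s with
    | nil => intro s' hl _ _; exact (List.length_eq_zero_iff.1 hl.symm).symm
    | cons i s ih =>
      intro s' hl hs hs'
      cases s' with
      | nil => simp at hl
      | cons j s' =>
        have hl' : s.length = s'.length := by simpa using hl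
        have e : s = s' := by
          apply ih s' hl'
          · cases i
            · rw [h0, map_sdiff_iff] at hs; exact hs.1
            · rw [h1, map_inf_iff] at hs; exact hs.1
          · cases j
            · rw [h0, map_sdiff_iff] at hs'; exact hs'.1
            · rw [h1, map_inf_iff] at hs'; exact hs'.1
        subst e
        cases i <;> cases j <;> simp_all [map_inf_iff, map_sdiff_iff]
  refine ⟨fun n => (Finset.univ : Finset (List.Vector Bool n)).sup
    (fun s => b s.1 ⊓ c s.1), fun σ => ?_⟩
  have hanti : Antitone fun n => b (seg σ n) := by
    refine antitone_nat_of_succ_le fun n => ?_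
    simp only [seg]
    cases σ n
    · rw [h0]; exact sdiff_le
    · rw [h1]; exact inf_le_left
  obtain ⟨φ, hφ⟩ := exists_point_of_finite (fun n => b (seg σ n)) (fun _ => true) (by
    intro t
    obtain ⟨φ, hφ⟩ := exists_point (hb (seg σ (t.sup id)))
    exact ⟨φ, fun i hi => map_mono φ (hanti (Finset.le_sup (f := id) hi)) hφ⟩)
  refine ⟨φ, fun n => ?_⟩
  rw [Bool.eq_iff_iff, map_finset_sup_iff]
  constructor
  · rintro ⟨s, -, hs⟩
    rw [← h1] at hs
    have := uniq φ _ (seg σ (n + 1)) (by rw [seg_length, List.length_cons, s.2]) hs (hφ (n + 1))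
    simp only [seg, List.cons.injEq] at this
    exact this.1.symm
  · intro hn
    refine ⟨⟨seg σ n, seg_length σ n⟩, Finset.mem_univ _, ?_⟩
    have := hφ (n + 1)
    simp only [seg, hn, h1] at this
    exact this

theorem exists_indep_continuum [Infinite A] (h : WeakSubseqSep A) :
    ∃ a : (ℕ → Bool) → A, ∀ σ : (ℕ → Bool) → Bool,
      ∃ φ : StoneSpace A, ∀ x, φ.1 (a x) = σ x := by
  classical
  obtain ⟨a₀, ha₀⟩ := exists_indep_nat h
  obtain ⟨a, ha⟩ : ∃ a : List Bool → A, ∀ τ : List Bool → Bool,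
      ∃ φ : StoneSpace A, ∀ s, φ.1 (a s) = τ s := by
    refine ⟨fun s => a₀ (Encodable.encode s), fun τ => ?_⟩
    obtain ⟨φ, hφ⟩ := ha₀ (fun n => τ ((Encodable.decode (α := List Bool) n).getD []))
    exact ⟨φ, fun s => by rw [hφ]; simp⟩
  let D : (ℕ → Bool) → ℕ → A := fun x n =>
    a (seg x n) \ (Finset.range n).sup (fun i => a (seg x i))
  have hD : ∀ (φ : StoneSpace A) x n, φ.1 (D x n) = true ↔
      φ.1 (a (seg x n)) = true ∧ ∀ i < n, ¬ φ.1 (a (seg x i)) = true := by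
    intro φ x n
    simp only [D]
    rw [map_sdiff_iff, map_finset_sup_iff]
    simp
  have hD0 : ∀ x n, D x n ≠ ⊥ := by
    intro x n
    obtain ⟨φ, hφ⟩ := ha (fun s => decide (s = seg x n))
    apply map_ne_bot φ
    rw [hD]
    refine ⟨by simp [hφ], fun i hi => ?_⟩
    rw [hφ, decide_eq_true_iff]
    intro he
    have := congrArg List.length he
    rw [seg_length, seg_length] at this
    omega
  have hDd : ∀ x m n, m ≠ n → D x m ⊓ D x n = ⊥ := by
    intro x m n hmn
    by_contra hne
    obtain ⟨φ, hφ⟩ := exists_point hne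
    rw [map_inf_iff, hD, hD] at hφ
    rcases lt_or_gt_of_ne hmn with h' | h'
    · exact hφ.2.2 m h' hφ.1.1
    · exact hφ.1.2 n h' hφ.2.1
  choose B hB1 hB2 using fun x =>
    h (D x) (injective_of_disjoint (hD0 x) (hDd x)) (hD0 x) (hDd x)
  refine ⟨B, fun σ => exists_point_of_finite B σ fun t => ?_⟩
  obtain ⟨N, hN⟩ : ∃ N : ℕ, ∀ x ∈ t, ∀ y ∈ t, x ≠ y → ∃ i < N, x i ≠ y i := by
    have : ∀ᶠ N : ℕ in Filter.atTop, ∀ x ∈ t, ∀ y ∈ t, x ≠ y → ∃ i < N, x i ≠ y i := by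
      rw [Filter.eventually_all_finset]
      intro x _
      rw [Filter.eventually_all_finset]
      intro y _
      by_cases hxy : x = y
      · simp [hxy]
      · obtain ⟨i, hi⟩ := Function.ne_iff.1 hxy
        filter_upwards [Filter.eventually_gt_atTop i] with N hN _
        exact ⟨i, hN, hi⟩
    exact this.exists
  have hex : ∀ x, ∃ n, N < n ∧ ∀ φ : StoneSpace A, φ.1 (D x n) = true → φ.1 (B x) = σ x := by
    intro x
    cases hσ : σ x
    · obtain ⟨n, hn, hlt⟩ := (hB2 x).exists_gt N
      refine ⟨n, hlt, fun φ hφ => ?_⟩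
      by_contra hc
      have hc' : φ.1 (B x) = true := by simpa using hc
      exact map_ne_bot φ ((map_inf_iff φ _ _).2 ⟨hφ, hc'⟩) hn
    · obtain ⟨n, hn, hlt⟩ := (hB1 x).exists_gt N
      exact ⟨n, hlt, fun φ hφ => map_mono φ hn hφ⟩
  choose k hk1 hk2 using hex
  obtain ⟨φ, hφ⟩ := ha (fun s => decide (∃ y ∈ t, s = seg y (k y)))
  refine ⟨φ, fun x hx => hk2 x φ ?_⟩
  rw [hD]
  refine ⟨by rw [hφ, decide_eq_true_iff]; exact ⟨x, hx, rfl⟩, fun i hi => ?_⟩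
  rw [hφ, decide_eq_true_iff]
  rintro ⟨y, hy, he⟩
  have hl := congrArg List.length he
  rw [seg_length, seg_length] at hl
  subst hl
  by_cases hxy : x = y
  · subst hxy; omega
  · obtain ⟨j, hj, hj'⟩ := hN x hx y hy hxy
    exact hj' (seg_agree he j (hj.trans (hk1 y)))

end WSS

/-- The Stone space of an infinite Boolean algebra with the weak subsequential separation
property contains a homeomorphic copy of `βℕ`. -/
theorem stoneCech_embeds_of_weakSubseqSep (A : Type*) [BooleanAlgebra A] [Infinite A]
    (h : WeakSubseqSep A) :
    ∃ e : StoneCech ℕ → StoneSpace A, Topology.IsEmbedding e := by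
  classical
  obtain ⟨a, ha⟩ := WSS.exists_indep_continuum h
  choose p hp using fun n : ℕ => ha (fun x => x n)
  have hpc : Continuous p := continuous_of_discreteTopology
  refine ⟨stoneCechExtend hpc, ?_⟩
  have hc := continuous_stoneCechExtend hpc
  refine (Continuous.isClosedEmbedding hc ?_).isEmbedding
  intro u v huv
  by_contra hne
  obtain ⟨U, V, hU, hV, huU, hvV, hUV⟩ := t2_separation hne
  let x : ℕ → Bool := fun n => decide (stoneCechUnit n ∈ U)
  let ψ : StoneCech ℕ → Bool := fun w => (stoneCechExtend hpc w).1 (a x)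
  have hψ : Continuous ψ := (WSS.continuous_eval (a x)).comp hc
  have hunit : ∀ n : ℕ, ψ (stoneCechUnit n) = decide (stoneCechUnit n ∈ U) := by
    intro n
    simp only [ψ]
    rw [stoneCechExtend_stoneCechUnit, hp]
  have key : ∀ (W : Set (StoneCech ℕ)) (w : StoneCech ℕ), IsOpen W → w ∈ W →
      ∃ n : ℕ, stoneCechUnit n ∈ W ∧ ψ (stoneCechUnit n) = ψ w := by
    intro W w hW hw
    have ho : IsOpen (W ∩ ψ ⁻¹' {ψ w}) := hW.inter ((isOpen_discrete _).preimage hψ)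
    obtain ⟨z, hz, n, rfl⟩ := denseRange_stoneCechUnit.inter_open_nonempty _ ho ⟨w, hw, rfl⟩
    exact ⟨n, hz.1, hz.2⟩
  obtain ⟨m, hm, hm'⟩ := key U u hU huU
  obtain ⟨n, hn, hn'⟩ := key V v hV hvV
  have huv' : ψ u = ψ v := by simp only [ψ]; rw [huv]
  rw [← hm', ← hn', hunit, hunit] at huv'
  have hnU : stoneCechUnit n ∉ U := fun hh => Set.disjoint_left.1 hUV hh hn
  simp [hm, hnU] at huv'
end

section
/- Let 𝒜 be a Boolean algebra with the weak subsequential separation property. Then 𝒜 has the positive Grothendieck property: whenever (A_n)_{n∈ℕ} is an injective sequence of pairwise disjoint nonzero elements of 𝒜, ε > 0, and (μ_n)_{n∈ℕ} is a uniformly bounded sequence of bounded finitely additive non-negative measures on 𝒜 with μ_n(A_n) > ε for all n, there exists A ∈ 𝒜 such that the real sequence (μ_n(A))_{n∈ℕ} does not converge. -/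
open scoped ENNReal

/-- A Boolean algebra with the weak subsequential separation property has the *positive
Grothendieck property*: for every injective sequence `(Aₙ)` of pairwise disjoint nonzero
elements, every `ε > 0` and every uniformly bounded sequence `(μₙ)` of finitely additive
non-negative measures on the algebra with `μₙ(Aₙ) > ε` for all `n`, there is an `a` for
which the real sequence `(μₙ(a))` does not converge. -/
theorem positive_grothendieck_of_weakSubseqSep (A : Type*) [BooleanAlgebra A]
    (h : WeakSubseqSep A) :
    ∀ As : ℕ → A, Function.Injective As → (∀ n, As n ≠ ⊥) →
      (∀ m n, m ≠ n → As m ⊓ As n = ⊥) →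
      ∀ ε : ℝ, 0 < ε →
        ∀ μ : ℕ → A → ℝ,
          (∀ n a, 0 ≤ μ n a) →
          (∀ n, μ n ⊥ = 0) →
          (∀ n a b, a ⊓ b = ⊥ → μ n (a ⊔ b) = μ n a + μ n b) →
          (∃ C : ℝ, ∀ n a, μ n a ≤ C) →
          (∀ n, ε < μ n (As n)) →
          ∃ a : A, ¬ ∃ L : ℝ, Filter.Tendsto (fun n => μ n a) Filter.atTop (nhds L) := by
  intro As hinj hne hdis ε hε μ hpos hbot hadd ⟨C, hC⟩ hlarge
  by_contra hcon
  push Not at hcon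
  choose L hL using hcon
  have hmono : ∀ n a b, a ≤ b → μ n a ≤ μ n b := by
    intro n a b hab
    have h1 := hadd n a (b \ a) inf_sdiff_self_right
    rw [sup_sdiff_cancel_right hab] at h1
    linarith [hpos n (b \ a)]
  have hLadd : ∀ a b, L a = L (a ⊓ b) + L (a \ b) := by
    intro a b
    refine tendsto_nhds_unique (hL a) ?_
    refine ((hL (a ⊓ b)).add (hL (a \ b))).congr fun n => ?_
    rw [← hadd n _ _ (inf_inf_sdiff a b), sup_inf_sdiff]
  have hbase : ∀ a, {n | As n ≤ a}.Infinite → ε ≤ L a := by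
    intro a ha
    by_contra hlt
    push Not at hlt
    have h1 := (hL a).eventually (gt_mem_nhds hlt)
    obtain ⟨n, hn1, hn2⟩ := ((Nat.frequently_atTop_iff_infinite.2 ha).and_eventually h1).exists
    have := hmono n _ _ hn1
    linarith [hlarge n]
  have hstep : ∀ k : ℕ, ∀ a, {n | As n ≤ a}.Infinite → (k : ℝ) * ε ≤ L a := by
    intro k
    induction k with
    | zero => intro a ha; have := hbase a ha; push_cast; linarith
    | succ k ih =>
      intro a ha
      let e := Nat.nth (fun n => As n ≤ a)
      have he : Function.Injective e := Nat.nth_injective ha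
      have hea : ∀ n, As (e n) ≤ a := fun n => Nat.nth_mem_of_infinite ha n
      obtain ⟨b, hb1, hb2⟩ := h (fun n => As (e n)) (hinj.comp he) (fun n => hne _)
        (fun m n hmn => hdis _ _ (he.ne hmn))
      have h1 : {n | As n ≤ a ⊓ b}.Infinite := by
        refine (hb1.image he.injOn).mono ?_
        rintro _ ⟨n, hn, rfl⟩
        exact le_inf (hea n) hn
      have h2 : {n | As n ≤ a \ b}.Infinite := by
        refine (hb2.image he.injOn).mono ?_
        rintro _ ⟨n, hn, rfl⟩
        exact le_sdiff.2 ⟨hea n, disjoint_iff.2 hn⟩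
      have := hbase _ h1
      have := ih _ h2
      rw [hLadd a b]
      push_cast
      linarith
  obtain ⟨k, hk⟩ := exists_nat_gt (C / ε)
  have h1 := hstep k ⊤ (by simpa using Set.infinite_univ)
  have h2 : L ⊤ ≤ C := le_of_tendsto' (hL ⊤) fun n => hC n ⊤
  rw [div_lt_iff₀ hε] at hk
  linarith
end

section
/- Let K be an infinite compact Hausdorff space with the following property: for every sequence (f_n)_{n∈ℕ} of continuous functions f_n : K → [0,1] that are pairwise disjoint (f_n · f_m = 0 for n ≠ m) and each not identically zero, there exists an infinite M ⊆ ℕ such that the family {f_n : n ∈ M} has a least upper bound in the lattice C(K, ℝ) of continuous real-valued functions on K with the pointwise order. Then K contains a homeomorphic copy of βℕ, the Čech–Stone compactification of the natural numbers. -/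
/-- The hypothesis of the theorem. -/
def SubseqSup (K : Type*) [TopologicalSpace K] : Prop :=
  ∀ f : ℕ → C(K, ℝ),
      (∀ (n : ℕ) (x : K), f n x ∈ Set.Icc (0 : ℝ) 1) →
      (∀ m n, m ≠ n → f m * f n = 0) →
      (∀ n, f n ≠ 0) →
      ∃ M : Set ℕ, M.Infinite ∧ ∃ g : C(K, ℝ), IsLUB (f '' M) g

/-- Splitting lemma: inside any infinite set `N` of indices we find an infinite co-infinite `M`
and a function lying above `f n` for `n ∈ M` and disjoint from `f n` for `n ∉ M`. -/
theorem SubseqSup.split {K : Type*} [TopologicalSpace K] (h : SubseqSup K)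
    (f : ℕ → C(K, ℝ)) (h01 : ∀ (n : ℕ) (x : K), f n x ∈ Set.Icc (0 : ℝ) 1)
    (hd : ∀ m n, m ≠ n → f m * f n = 0) (hne : ∀ n, f n ≠ 0)
    (N : Set ℕ) (hN : N.Infinite) :
    ∃ M : Set ℕ, M ⊆ N ∧ M.Infinite ∧ (N \ M).Infinite ∧ ∃ g : C(K, ℝ),
      (∀ x, 0 ≤ g x) ∧ (∀ n ∈ M, ∀ x, f n x ≤ g x) ∧
      (∀ n, n ∉ M → ∀ x, f n x ≠ 0 → g x = 0) := by
  have hinj : Function.Injective (Nat.nth (· ∈ N)) := Nat.nth_injective hN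
  set e := Nat.nth (· ∈ N) with he
  have heN : ∀ n, e n ∈ N := fun n => Nat.nth_mem_of_infinite hN n
  obtain ⟨M, hM, g, hg⟩ := h (fun n => f (e (2 * n))) (fun n x => h01 _ x)
    (fun m n hmn => hd _ _ (fun hh => hmn (by have := hinj hh; omega))) (fun n => hne _)
  have hub : ∀ n ∈ M, ∀ x, f (e (2 * n)) x ≤ g x := fun n hn x =>
    hg.1 ⟨n, hn, rfl⟩ x
  have hg0 : ∀ x, 0 ≤ g x := by
    obtain ⟨n, hn⟩ := hM.nonempty
    intro x
    exact (h01 _ x).1.trans (hub n hn x)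
  refine ⟨(fun n => e (2 * n)) '' M, ?_, ?_, ?_, g, hg0, ?_, ?_⟩
  · rintro _ ⟨n, _, rfl⟩
    exact heN _
  · refine hM.image (fun a _ b _ hab => ?_)
    have := hinj hab
    omega
  · have : (Set.range fun n => e (2 * n + 1)).Infinite :=
      Set.infinite_range_of_injective (fun a b hab => by have := hinj hab; omega)
    refine this.mono ?_
    rintro _ ⟨n, rfl⟩
    refine ⟨heN _, ?_⟩
    rintro ⟨m, _, hm⟩
    have := hinj hm
    omega
  · rintro _ ⟨n, hn, rfl⟩ x
    exact hub n hn x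
  · intro n hn x hx
    have key : g ≤ (g - f n) ⊔ 0 := by
      apply hg.2
      rintro _ ⟨m, hm, rfl⟩
      intro y
      have hmn : e (2 * m) ≠ n := fun hh => hn ⟨m, hm, hh⟩
      have h0 : f (e (2 * m)) y * f n y = 0 := by
        have := congrArg (fun F : C(K, ℝ) => F y) (hd _ _ hmn)
        simpa using this
      have h1 := hub m hm y
      change f (e (2 * m)) y ≤ max (g y - f n y) 0
      rcases mul_eq_zero.1 h0 with h0 | h0
      · rw [h0]; exact le_sup_right
      · rw [h0, sub_zero]; exact h1.trans le_sup_left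
    have hk : g x ≤ max (g x - f n x) 0 := key x
    have hp : 0 < f n x := lt_of_le_of_ne (h01 n x).1 (Ne.symm hx)
    rcases le_sup_iff.1 hk with hk | hk
    · linarith
    · exact le_antisymm hk (hg0 x)

/-- compactness, for families of closed sets -/
theorem compact_fip {K ι : Type*} [TopologicalSpace K] [CompactSpace K]
    (C : ι → Set K) (hC : ∀ i, IsClosed (C i))
    (hf : ∀ s : Finset ι, ∃ p, ∀ i ∈ s, p ∈ C i) : ∃ p, ∀ i, p ∈ C i := by
  have := (isCompact_univ (X := K)).inter_iInter_nonempty C hC (fun s => by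
    obtain ⟨p, hp⟩ := hf s
    exact ⟨p, trivial, by simpa using hp⟩)
  obtain ⟨p, _, hp⟩ := this
  exact ⟨p, by simpa using hp⟩

/-- the indices with a given pattern -/
def patt {K : Type*} [TopologicalSpace K] (x : ℕ → K) (k : ℕ) (h : ℕ → C(K, ℝ))
    (A : Finset ℕ) : Set ℕ :=
  {n | ∀ i < k, h i (x n) = if i ∈ A then 1 else 0}

theorem patt_disj {K : Type*} [TopologicalSpace K] (x : ℕ → K) (k : ℕ) (h : ℕ → C(K, ℝ))
    (A B : Finset ℕ) (hA : A ⊆ Finset.range k) (hB : B ⊆ Finset.range k) (n : ℕ)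
    (hnA : n ∈ patt x k h A) (hnB : n ∈ patt x k h B) : A = B := by
  ext i
  by_cases hi : i < k
  · have h1 := hnA i hi
    rw [hnB i hi] at h1
    by_cases ha : i ∈ A <;> by_cases hb : i ∈ B <;> simp_all
  · have : i ∉ Finset.range k := by simpa using hi
    exact ⟨fun h => absurd (hA h) this, fun h => absurd (hB h) this⟩

/-- a finite independent sequence, spread infinitely often on the points `x n` -/
def GoodSeq {K : Type*} [TopologicalSpace K] (x : ℕ → K) (k : ℕ) (h : ℕ → C(K, ℝ)) : Prop :=
  (∀ A ∈ (Finset.range k).powerset, (patt x k h A).Infinite) ∧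
    ∀ i y, h i y ∈ Set.Icc (0 : ℝ) 1

theorem goodSeq_step {K : Type*} [TopologicalSpace K] (hK : SubseqSup K)
    (f : ℕ → C(K, ℝ)) (h01 : ∀ (n : ℕ) (x : K), f n x ∈ Set.Icc (0 : ℝ) 1)
    (hd : ∀ m n, m ≠ n → f m * f n = 0) (x : ℕ → K) (hx : ∀ n, f n (x n) = 1)
    (k : ℕ) (h : ℕ → C(K, ℝ)) (hg : GoodSeq x k h) :
    ∃ h' : ℕ → C(K, ℝ), GoodSeq x (k + 1) h' ∧ ∀ i < k, h' i = h i := by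
  have hne : ∀ n, f n ≠ 0 := fun n hn => by
    have := hx n
    rw [hn] at this
    simp at this
  have hs : ∀ A : Finset ℕ, ∃ M : Set ℕ, ∃ g : C(K, ℝ), A ∈ (Finset.range k).powerset →
      M ⊆ patt x k h A ∧ M.Infinite ∧ (patt x k h A \ M).Infinite ∧
      (∀ x, 0 ≤ g x) ∧ (∀ n ∈ M, ∀ x, f n x ≤ g x) ∧
      (∀ n, n ∉ M → ∀ x, f n x ≠ 0 → g x = 0) := by
    intro A
    by_cases hA : A ∈ (Finset.range k).powerset
    · obtain ⟨M, h1, h2, h3, g, h4⟩ := hK.split f h01 hd hne _ (hg.1 A hA)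
      exact ⟨M, g, fun _ => ⟨h1, h2, h3, h4⟩⟩
    · exact ⟨∅, 0, fun h => absurd h hA⟩
  choose M g hMg using hs
  let G : C(K, ℝ) := 1 ⊓ ∑ A ∈ (Finset.range k).powerset, g A
  have hGv : ∀ y, G y = min 1 (∑ A ∈ (Finset.range k).powerset, g A y) := by
    intro y
    simp [G]
  have hsum : ∀ y, 0 ≤ ∑ A ∈ (Finset.range k).powerset, g A y := fun y =>
    Finset.sum_nonneg (fun A hA => (hMg A hA).2.2.2.1 y)
  have hG1 : ∀ A ∈ (Finset.range k).powerset, ∀ n ∈ M A, G (x n) = 1 := by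
    intro A hA n hn
    rw [hGv]
    apply min_eq_left
    calc (1 : ℝ) = f n (x n) := (hx n).symm
      _ ≤ g A (x n) := (hMg A hA).2.2.2.2.1 n hn _
      _ ≤ _ := Finset.single_le_sum (f := fun A => g A (x n))
        (fun B hB => (hMg B hB).2.2.2.1 (x n)) hA
  have hG0 : ∀ A ∈ (Finset.range k).powerset, ∀ n ∈ patt x k h A \ M A, G (x n) = 0 := by
    intro A hA n hn
    rw [hGv, Finset.sum_eq_zero, min_eq_right zero_le_one]
    intro B hB
    refine (hMg B hB).2.2.2.2.2 n ?_ _ (by rw [hx n]; exact one_ne_zero)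
    intro hnB
    have := patt_disj x k h A B (Finset.mem_powerset.1 hA) (Finset.mem_powerset.1 hB) n hn.1
      ((hMg B hB).1 hnB)
    subst this
    exact hn.2 hnB
  refine ⟨Function.update h k G, ⟨?_, ?_⟩, ?_⟩
  · intro A hA
    have hB : A.erase k ∈ (Finset.range k).powerset := by
      rw [Finset.mem_powerset] at hA ⊢
      intro i hi
      have h1 := hA (Finset.mem_of_mem_erase hi)
      have h2 := Finset.ne_of_mem_erase hi
      simp at h1 ⊢
      omega
    by_cases hk : k ∈ A
    · refine (hMg _ hB).2.1.mono ?_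
      intro n hn i hi
      rcases Nat.lt_succ_iff_lt_or_eq.1 hi with hi | rfl
      · rw [Function.update_of_ne hi.ne, (hMg _ hB).1 hn i hi]
        simp [hi.ne]
      · rw [Function.update_self, hG1 _ hB n hn]
        simp [hk]
    · refine (hMg _ hB).2.2.1.mono ?_
      intro n hn i hi
      rcases Nat.lt_succ_iff_lt_or_eq.1 hi with hi | rfl
      · rw [Function.update_of_ne hi.ne, hn.1 i hi]
        simp [hi.ne]
      · rw [Function.update_self, hG0 _ hB n hn]
        simp [hk]
  · intro i y
    by_cases hi : i = k
    · subst hi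
      rw [Function.update_self, hGv]
      exact ⟨le_min zero_le_one (hsum y), min_le_left _ _⟩
    · rw [Function.update_of_ne hi]
      exact hg.2 i y
  · intro i hi
    rw [Function.update_of_ne hi.ne]

/-- There is an independent sequence of functions. -/
theorem exists_indep {K : Type*} [TopologicalSpace K] [CompactSpace K] [T2Space K] [Infinite K]
    (hK : SubseqSup K) : ∃ h : ℕ → C(K, ℝ), (∀ i y, h i y ∈ Set.Icc (0 : ℝ) 1) ∧
      ∀ A : Set ℕ, ∃ p, ∀ i, (i ∈ A → h i p = 1) ∧ (i ∉ A → h i p = 0) := by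
  classical
  obtain ⟨U, hUi, hUo, hUd⟩ := exists_seq_infinite_isOpen_pairwise_disjoint K
  choose x hxU using fun n => (hUi n).nonempty
  have hf : ∀ n, ∃ f : C(K, ℝ), Set.EqOn f 0 (U n)ᶜ ∧ Set.EqOn f 1 {x n} ∧
      ∀ y, f y ∈ Set.Icc (0 : ℝ) 1 := fun n =>
    exists_continuous_zero_one_of_isClosed (hUo n).isClosed_compl isClosed_singleton
      (by simpa using hxU n)
  choose f hf0 hf1 hf01 using hf
  have hd : ∀ m n, m ≠ n → f m * f n = 0 := by
    intro m n hmn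
    ext y
    by_cases hy : y ∈ U m
    · have hy' : y ∉ U n := fun h => Set.disjoint_left.1 (hUd hmn) hy h
      have := hf0 n hy'
      simp_all
    · have := hf0 m hy
      simp_all
  have hx : ∀ n, f n (x n) = 1 := fun n => hf1 n rfl
  have step := goodSeq_step hK f hf01 hd x hx
  have h0 : GoodSeq x 0 (fun _ => 0) := by
    refine ⟨fun A _ => ?_, fun i y => by simp⟩
    have : patt x 0 (fun _ => (0 : C(K, ℝ))) A = Set.univ := by
      ext n; simp [patt]
    rw [this]
    exact Set.infinite_univ
  choose! S hS1 hS2 using step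
  let H : ℕ → ℕ → C(K, ℝ) := fun n => Nat.rec (fun _ => 0) (fun k h => S k h) n
  have hHs : ∀ k, H (k + 1) = S k (H k) := fun k => rfl
  have hH : ∀ k, GoodSeq x k (H k) := by
    intro k
    induction k with
    | zero => exact h0
    | succ k ih => rw [hHs]; exact hS1 k _ ih
  have hcoh : ∀ i k, H (i + 1 + k) i = H (i + 1) i := by
    intro i k
    induction k with
    | zero => rfl
    | succ k ih =>
      rw [← add_assoc, hHs, hS2 _ _ (hH _) i (by omega), ih]
  refine ⟨fun i => H (i + 1) i, fun i y => (hH (i + 1)).2 i y, fun A => ?_⟩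
  have := compact_fip (K := K) (fun i => {p | H (i + 1) i p = if i ∈ A then 1 else 0})
    (fun i => isClosed_eq (H (i + 1) i).continuous continuous_const) ?_
  · obtain ⟨p, hp⟩ := this
    refine ⟨p, fun i => ⟨fun hi => ?_, fun hi => ?_⟩⟩
    · simpa [hi] using hp i
    · simpa [hi] using hp i
  · intro s
    obtain ⟨k, hk⟩ : ∃ k, ∀ i ∈ s, i < k := ⟨s.sup id + 1, fun i hi =>
      Nat.lt_succ_of_le (Finset.le_sup (f := id) hi)⟩
    obtain ⟨n, hn⟩ := ((hH k).1 ((Finset.range k).filter (· ∈ A)) (by simp)).nonempty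
    refine ⟨x n, fun i hi => ?_⟩
    have h1 := hn i (hk i hi)
    obtain ⟨j, rfl⟩ : ∃ j, k = i + 1 + j := ⟨k - (i + 1), by have := hk i hi; omega⟩
    rw [hcoh] at h1
    rw [Set.mem_ofPred_eq, h1]
    have := hk i hi
    simp only [Finset.mem_filter, Finset.mem_range, this, true_and]

/-- code of the node of length `n` of the branch `z` -/
noncomputable def node (z : Set ℕ) (n : ℕ) : ℕ :=
  open Classical in Encodable.encode (n, (Finset.range n).filter (· ∈ z))

theorem node_eq {z w : Set ℕ} {m n : ℕ} (h : node z m = node w n) :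
    m = n ∧ ∀ i < m, i ∈ z ↔ i ∈ w := by
  classical
  have h := Encodable.encode_injective h
  rw [Prod.mk.injEq] at h
  obtain ⟨rfl, h⟩ := h
  refine ⟨rfl, fun i hi => ?_⟩
  have := Finset.ext_iff.1 h i
  simpa [hi] using this

/-- An independent family of pairs of closed sets indexed by the subsets of `ℕ`. -/
theorem exists_indep_pairs {K : Type*} [TopologicalSpace K] [CompactSpace K] [T2Space K]
    [Infinite K] (hK : SubseqSup K) : ∃ g : Set ℕ → C(K, ℝ),
      ∀ E : Set (Set ℕ), ∃ p, ∀ z, (z ∈ E → 1 ≤ g z p) ∧ (z ∉ E → g z p = 0) := by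
  classical
  obtain ⟨h, h01, hind⟩ := exists_indep hK
  let F : Set ℕ → ℕ → C(K, ℝ) := fun z n =>
    (((2 : ℝ) • h (node z n) - 1) ⊔ 0) *
      ∏ m ∈ Finset.range n, ((1 - (2 : ℝ) • h (node z m)) ⊔ 0)
  have hFv : ∀ z n y, F z n y = max (2 * h (node z n) y - 1) 0 *
      ∏ m ∈ Finset.range n, max (1 - 2 * h (node z m) y) 0 := by
    intro z n y
    simp [F, ContinuousMap.prod_apply]
  have hF01 : ∀ z n y, F z n y ∈ Set.Icc (0 : ℝ) 1 := by
    intro z n y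
    rw [hFv]
    refine ⟨mul_nonneg (le_max_right _ _) (Finset.prod_nonneg fun _ _ => le_max_right _ _), ?_⟩
    refine mul_le_one₀ ?_ (Finset.prod_nonneg fun _ _ => le_max_right _ _)
      (Finset.prod_le_one (fun _ _ => le_max_right _ _) fun m _ => ?_)
    · have := h01 (node z n) y
      exact max_le (by linarith [this.2]) zero_le_one
    · have := h01 (node z m) y
      exact max_le (by linarith [this.1]) zero_le_one
  have hFd' : ∀ z m n, m < n → F z m * F z n = 0 := by
    intro z m n hmn
    ext y
    rw [ContinuousMap.mul_apply, hFv, hFv, ContinuousMap.zero_apply]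
    rcases le_total (h (node z m) y) (1 / 2) with hh | hh
    · rw [max_eq_right (by linarith : 2 * h (node z m) y - 1 ≤ 0)]
      simp
    · rw [Finset.prod_eq_zero (i := m) (s := Finset.range n) (by simpa using hmn)
        (max_eq_right (by linarith))]
      simp
  have hFd : ∀ z m n, m ≠ n → F z m * F z n = 0 := by
    intro z m n hmn
    rcases lt_or_gt_of_ne hmn with hlt | hlt
    · exact hFd' z m n hlt
    · rw [mul_comm]; exact hFd' z n m hlt
  have hF1 : ∀ z n p, h (node z n) p = 1 → (∀ m < n, h (node z m) p = 0) → F z n p = 1 := by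
    intro z n p h1 h2
    rw [hFv, h1, Finset.prod_eq_one]
    · norm_num
    · intro m hm
      rw [h2 m (by simpa using hm)]
      norm_num
  have hFne : ∀ z n, F z n ≠ 0 := by
    intro z n h0
    obtain ⟨p, hp⟩ := hind {node z n}
    have := hF1 z n p ((hp _).1 rfl) (fun m hm => (hp _).2 (fun hh => by
      have := (node_eq hh).1
      omega))
    rw [h0] at this
    simp at this
  have hs := fun z => hK.split (F z) (hF01 z) (hFd z) (hFne z) Set.univ Set.infinite_univ
  choose M hMu hMi hMc g hg0 hg1 hg2 using hs
  refine ⟨g, fun E => ?_⟩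
  have := compact_fip (K := K) (fun z => {p | (z ∈ E → 1 ≤ g z p) ∧ (z ∉ E → g z p = 0)})
    (fun z => ?_) ?_
  · exact this
  · by_cases hz : z ∈ E
    · simpa [hz] using isClosed_le continuous_const (g z).continuous
    · simpa [hz] using isClosed_eq (g z).continuous continuous_const
  · intro Z
    -- a level separating the members of `Z`
    have hsep : ∃ D : ℕ, ∀ z ∈ Z, ∀ w ∈ Z, (∀ i < D, i ∈ z ↔ i ∈ w) → z = w := by
      have : ∀ q : Set ℕ × Set ℕ, ∃ d : ℕ, (∀ i < d, i ∈ q.1 ↔ i ∈ q.2) → q.1 = q.2 := by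
        intro q
        by_cases hq : q.1 = q.2
        · exact ⟨0, fun _ => hq⟩
        · by_contra hcon
          push Not at hcon
          apply hq
          ext i
          exact (hcon (i + 1)).1 i (Nat.lt_succ_self i)
      choose d hd using this
      refine ⟨(Z ×ˢ Z).sup d, fun z hz w hw hzw => hd (z, w) fun i hi => hzw i ?_⟩
      exact lt_of_lt_of_le hi (Finset.le_sup (f := d) (Finset.mk_mem_product hz hw))
    obtain ⟨D, hD⟩ := hsep
    have hN : ∀ z, ∃ n, D ≤ n ∧ (z ∈ E ↔ n ∈ M z) := by
      intro z
      by_cases hz : z ∈ E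
      · obtain ⟨n, hn, hDn⟩ := (hMi z).exists_gt D
        exact ⟨n, hDn.le, by simp [hz, hn]⟩
      · obtain ⟨n, hn, hDn⟩ := (hMc z).exists_gt D
        exact ⟨n, hDn.le, by simp [hz, hn.2]⟩
    choose N hND hNE using hN
    obtain ⟨p, hp⟩ := hind {j | ∃ z ∈ Z, node z (N z) = j}
    refine ⟨p, fun z hz => ?_⟩
    have hv : F z (N z) p = 1 := by
      apply hF1
      · exact (hp _).1 ⟨z, hz, rfl⟩
      · intro m hm
        refine (hp _).2 ?_
        rintro ⟨w, hw, hwz⟩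
        obtain ⟨h1, h2⟩ := node_eq hwz
        have : w = z := hD w hw z hz (fun i hi => h2 i (hi.trans_le (hND w)))
        subst this
        omega
    refine ⟨fun hzE => ?_, fun hzE => ?_⟩
    · rw [← hv]
      exact hg1 z _ ((hNE z).1 hzE) p
    · exact hg2 z (N z) (fun hh => hzE ((hNE z).2 hh)) p (by rw [hv]; exact one_ne_zero)

/-- If `K` is an infinite compact Hausdorff space such that every pairwise disjoint
sequence of nonzero continuous functions `K → [0,1]` has an infinite subfamily with a
least upper bound in the lattice `C(K, ℝ)`, then `K` contains a homeomorphic copy of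
`βℕ`. -/
theorem stoneCech_embeds_of_subsequential_suprema (K : Type*) [TopologicalSpace K]
    [CompactSpace K] [T2Space K] [Infinite K]
    (h : ∀ f : ℕ → C(K, ℝ),
      (∀ (n : ℕ) (x : K), f n x ∈ Set.Icc (0 : ℝ) 1) →
      (∀ m n, m ≠ n → f m * f n = 0) →
      (∀ n, f n ≠ 0) →
      ∃ M : Set ℕ, M.Infinite ∧ ∃ g : C(K, ℝ), IsLUB (f '' M) g) :
    ∃ e : StoneCech ℕ → K, Topology.IsEmbedding e := by
  have hK : SubseqSup K := h
  obtain ⟨g, hg⟩ := exists_indep_pairs hK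
  choose x hx using fun n : ℕ => hg {z | n ∈ z}
  have hxc : Continuous x := continuous_of_discreteTopology
  have hec : Continuous (stoneCechExtend hxc) := continuous_stoneCechExtend hxc
  refine ⟨stoneCechExtend hxc, (hec.isClosedEmbedding ?_).isEmbedding⟩
  intro p q hpq
  by_contra hne
  obtain ⟨u, hu0, hu1, -⟩ := exists_continuous_zero_one_of_isClosed
    (isClosed_singleton (x := p)) (isClosed_singleton (x := q)) (by simpa using hne)
  have hup : u p = 0 := hu0 rfl
  have huq : u q = 1 := hu1 rfl
  let S : Set ℕ := {n | u (stoneCechUnit n) < 1 / 2}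
  have hgc : Continuous fun r => g S (stoneCechExtend hxc r) := (g S).continuous.comp hec
  have key1 : 1 ≤ g S (stoneCechExtend hxc p) := by
    by_contra hcon
    have ho : IsOpen ({r | u r < 1 / 2} ∩ {r | g S (stoneCechExtend hxc r) < 1}) :=
      (isOpen_lt u.continuous continuous_const).inter (isOpen_lt hgc continuous_const)
    obtain ⟨n, hn1, hn2⟩ := denseRange_stoneCechUnit.exists_mem_open ho
      ⟨p, by simp [hup], not_le.1 hcon⟩
    have := (hx n S).1 hn1
    rw [Set.mem_ofPred_eq, stoneCechExtend_stoneCechUnit] at hn2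
    linarith
  have key2 : g S (stoneCechExtend hxc q) < 1 := by
    by_contra hcon
    have ho : IsOpen ({r | 1 / 2 < u r} ∩ {r | 0 < g S (stoneCechExtend hxc r)}) :=
      (isOpen_lt continuous_const u.continuous).inter (isOpen_lt continuous_const hgc)
    obtain ⟨n, hn1, hn2⟩ := denseRange_stoneCechUnit.exists_mem_open ho
      ⟨q, by rw [Set.mem_ofPred_eq, huq]; norm_num, lt_of_lt_of_le one_pos (not_lt.1 hcon)⟩
    have := (hx n S).2 (fun hh : u (stoneCechUnit n) < 1 / 2 => lt_asymm hh hn1)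
    rw [Set.mem_ofPred_eq, stoneCechExtend_stoneCechUnit] at hn2
    linarith
  rw [hpq] at key1
  linarith
end
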